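/- Let G be a connected Cohen–Macaulay closed graph with t maximal cliques and let m ≥ 2. Write t − 1 = q(2m−1) + A with 0 ≤ A < 2m−1, and set B = (A+1) mod 2 if A > 0 and B = 0 if A = 0. Then the v-number of the generalized binomial edge ideal satisfies v(J_{K_m,G}) = q·m + ⌊(A+1)/2⌋ + B. -/

import Mathlib

open MvPolynomial

noncomputable def minor (K : Type*) [Field K] (i j k l : ℕ) : MvPolynomial (ℕ × ℕ) K :=
  X (i, k) * X (j, l) - X (i, l) * X (j, k)

noncomputable def genBEI (K : Type*) [Field K] (m : ℕ) (G : SimpleGraph ℕ) :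
    Ideal (MvPolynomial (ℕ × ℕ) K) :=
  Ideal.span {f | ∃ i j k l : ℕ, 1 ≤ i ∧ i < j ∧ j ≤ m ∧ k < l ∧ G.Adj k l ∧ f = minor K i j k l}

noncomputable def vNumber {K : Type*} [Field K] (I : Ideal (MvPolynomial (ℕ × ℕ) K)) : ℕ :=
  sInf {d : ℕ | ∃ f : MvPolynomial (ℕ × ℕ) K,
    f.IsHomogeneous d ∧ (Submodule.colon I (Ideal.span {f})).IsPrime ∧
    Submodule.colon I (Ideal.span {f}) ∈ associatedPrimes (MvPolynomial (ℕ × ℕ) K)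
      (MvPolynomial (ℕ × ℕ) K ⧸ I)}

namespace VN

def cc (T : Finset ℕ) (x : ℕ) : ℕ := (T.filter (· < x)).card

def pr (m n : ℕ) (p : ℕ × ℕ) : Prop := 1 ≤ p.1 ∧ p.1 ≤ m ∧ 1 ≤ p.2 ∧ p.2 ≤ n

instance (m n : ℕ) (p : ℕ × ℕ) : Decidable (pr m n p) := by
  unfold pr; infer_instance

def rr (m n : ℕ) (T : Finset ℕ) (p : ℕ × ℕ) : ℕ × ℕ :=
  if pr m n p then (p.1, cc T p.2) else (0, 0)

def ww (m n : ℕ) (p : ℕ × ℕ) : ℕ × ℕ := if pr m n p then (1, p.2) else p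

lemma rr_pr {m n : ℕ} {T : Finset ℕ} {p : ℕ × ℕ} (h : pr m n p) :
    rr m n T p = (p.1, cc T p.2) := if_pos h

lemma rr_npr {m n : ℕ} {T : Finset ℕ} {p : ℕ × ℕ} (h : ¬ pr m n p) :
    rr m n T p = (0, 0) := if_neg h

lemma ww_pr {m n : ℕ} {p : ℕ × ℕ} (h : pr m n p) : ww m n p = (1, p.2) := if_pos h

lemma ww_npr {m n : ℕ} {p : ℕ × ℕ} (h : ¬ pr m n p) : ww m n p = p := if_neg h

noncomputable def gg (K : Type*) [Field K] (m n : ℕ) (T : Finset ℕ) (p : ℕ × ℕ) :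
    MvPolynomial ((ℕ × ℕ) ⊕ (ℕ × ℕ)) K :=
  if pr m n p ∧ p.2 ∈ T then 0 else X (Sum.inl (rr m n T p)) * X (Sum.inr (ww m n p))

lemma gg_bad {K : Type*} [Field K] {m n : ℕ} {T : Finset ℕ} {p : ℕ × ℕ}
    (h : pr m n p ∧ p.2 ∈ T) : gg K m n T p = 0 := if_pos h

lemma gg_good {K : Type*} [Field K] {m n : ℕ} {T : Finset ℕ} {p : ℕ × ℕ}
    (h : ¬ (pr m n p ∧ p.2 ∈ T)) :
    gg K m n T p = X (Sum.inl (rr m n T p)) * X (Sum.inr (ww m n p)) := if_neg h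

noncomputable def phi (K : Type*) [Field K] (m n : ℕ) (T : Finset ℕ) :
    MvPolynomial (ℕ × ℕ) K →ₐ[K] MvPolynomial ((ℕ × ℕ) ⊕ (ℕ × ℕ)) K :=
  aeval (gg K m n T)

abbrev Ex := (ℕ × ℕ) →₀ ℕ

noncomputable def mk (a b : Ex) : ((ℕ × ℕ) ⊕ (ℕ × ℕ)) →₀ ℕ := Finsupp.sumElim a b

lemma mk_inj {a b a' b' : Ex} : mk a b = mk a' b' ↔ a = a' ∧ b = b' := by
  constructor
  · intro h
    constructor
    · ext x
      have := DFunLike.congr_fun h (Sum.inl x)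
      simpa [mk] using this
    · ext x
      have := DFunLike.congr_fun h (Sum.inr x)
      simpa [mk] using this
  · rintro ⟨rfl, rfl⟩; rfl

lemma exists_mk (e : ((ℕ × ℕ) ⊕ (ℕ × ℕ)) →₀ ℕ) : ∃ a b, e = mk a b := by
  refine ⟨(Finsupp.sumFinsuppEquivProdFinsupp e).1, (Finsupp.sumFinsuppEquivProdFinsupp e).2, ?_⟩
  ext x
  cases x <;> simp [mk]

lemma sumElim_add' (a b a' b' : Ex) : mk (a + a') (b + b') = mk a b + mk a' b' := by
  ext x
  cases x <;> simp [mk]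

/-- generic monomial image -/
lemma map_prod (r w : ℕ × ℕ → ℕ × ℕ) (K : Type*) [Field K] (u : Ex) :
    (u.prod fun p k => (X (Sum.inl (r p)) * X (Sum.inr (w p)) :
      MvPolynomial ((ℕ × ℕ) ⊕ (ℕ × ℕ)) K) ^ k) =
    monomial (mk (u.mapDomain r) (u.mapDomain w)) 1 := by
  induction u using Finsupp.induction_linear with
  | zero =>
    have : mk 0 0 = 0 := by ext x; cases x <;> simp [mk]
    simp [this]
  | add f g hf hg =>
    rw [Finsupp.prod_add_index' (by simp) (by intros; rw [pow_add]), hf, hg,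
      Finsupp.mapDomain_add, Finsupp.mapDomain_add, sumElim_add', monomial_mul, one_mul]
  | single p k =>
    rw [Finsupp.prod_single_index (by simp), mul_pow, X_pow_eq_monomial, X_pow_eq_monomial,
      monomial_mul, one_mul, Finsupp.mapDomain_single, Finsupp.mapDomain_single]
    congr 1
    congr 1
    ext x
    cases x <;> simp [mk, Finsupp.single_apply]

/-- sums of a Finsupp over a fibre -/
lemma mapDomain_eq_sum {α β : Type*} [DecidableEq β] (g : α → β) (a : α →₀ ℕ) (y : β)
    (F : Finset α) (hF : ∀ x, a x ≠ 0 → (x ∈ F ↔ g x = y)) (hF' : ∀ x ∈ F, g x = y) :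
    a.mapDomain g y = ∑ x ∈ F, a x := by
  classical
  rw [Finsupp.mapDomain, Finsupp.sum_apply, Finsupp.sum]
  simp only [Finsupp.single_apply]
  rw [← Finset.sum_filter]
  apply Finset.sum_subset
  · intro x hx
    simp only [Finset.mem_filter, Finsupp.mem_support_iff] at hx
    exact (hF x hx.1).2 hx.2
  · intro x hx hx'
    by_contra h
    exact hx' (by simp [h, hF' x hx])

lemma mapDomain_ne_zero {α β : Type*} (g : α → β) (a : α →₀ ℕ) (x : α) (hx : a x ≠ 0) :
    a.mapDomain g (g x) ≠ 0 := by
  classical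
  rw [Finsupp.mapDomain, Finsupp.sum_apply, Finsupp.sum]
  intro h
  rw [Finset.sum_eq_zero_iff] at h
  have := h x (by simpa using hx)
  simp at this
  exact hx this

lemma exists_of_mapDomain_ne_zero {α β : Type*} (g : α → β) (a : α →₀ ℕ) (y : β)
    (hy : a.mapDomain g y ≠ 0) : ∃ x, g x = y ∧ a x ≠ 0 := by
  classical
  have := Finsupp.mapDomain_support (f := g) (s := a) (Finsupp.mem_support_iff.2 hy)
  obtain ⟨x, hx, rfl⟩ := Finset.mem_image.1 this
  exact ⟨x, rfl, by simpa using hx⟩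

lemma exists_lt_of_mapDomain_eq {α β : Type*} (g : α → β) (a a' : α →₀ ℕ)
    (h : a.mapDomain g = a'.mapDomain g) (x : α) (hx : a' x < a x) :
    ∃ x', g x' = g x ∧ a x' < a' x' := by
  classical
  by_contra hcon
  push Not at hcon
  let F := (a.support ∪ a'.support).filter (fun z => g z = g x)
  have h1 := mapDomain_eq_sum g a (g x) F (by intro z hz; simp [F, hz]) (by intro z hz; simp [F] at hz; tauto)
  have h2 := mapDomain_eq_sum g a' (g x) F (by intro z hz; simp [F, hz]) (by intro z hz; simp [F] at hz; tauto)
  have h3 : ∑ z ∈ F, a' z < ∑ z ∈ F, a z := by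
    apply Finset.sum_lt_sum
    · intro z hz
      exact hcon z (by simp [F] at hz; tauto)
    · exact ⟨x, by simp [F]; left; omega, hx⟩
  rw [h] at h1
  omega

section coeffs
variable {K : Type*} [Field K] {m n : ℕ}

/-- `b` has no proper tokens on `T` -/
def zon (b : Ex) (T : Finset ℕ) : Prop := ∀ v ∈ T, b (1, v) = 0

lemma not_bad_of_zon {b u : Ex} {T : Finset ℕ} (hb : zon b T) (hu : u.mapDomain (ww m n) = b)
    (p : ℕ × ℕ) (hp : u p ≠ 0) : ¬ (pr m n p ∧ p.2 ∈ T) := by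
  rintro ⟨h1, h2⟩
  have := mapDomain_ne_zero (ww m n) u p hp
  rw [hu] at this
  apply this
  rw [ww_pr h1]
  exact hb _ h2

lemma phi_monomial_bad (T : Finset ℕ) (u : Ex) (c : K) (p : ℕ × ℕ) (hp : u p ≠ 0)
    (hb : pr m n p ∧ p.2 ∈ T) : phi K m n T (monomial u c) = 0 := by
  rw [phi, aeval_monomial]
  have : (u.prod fun i k => gg K m n T i ^ k) = 0 := by
    apply Finset.prod_eq_zero (i := p) (by simpa using hp)
    simp only [gg_bad hb, zero_pow hp]
  rw [this, mul_zero]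

lemma phi_monomial_good (T : Finset ℕ) (u : Ex) (c : K)
    (hb : ∀ p, u p ≠ 0 → ¬ (pr m n p ∧ p.2 ∈ T)) :
    phi K m n T (monomial u c) =
      monomial (mk (u.mapDomain (rr m n T)) (u.mapDomain (ww m n))) c := by
  rw [phi, aeval_monomial]
  have : (u.prod fun i k => gg K m n T i ^ k) =
     (u.prod fun p k => (X (Sum.inl (rr m n T p)) * X (Sum.inr (ww m n p)) :
      MvPolynomial ((ℕ × ℕ) ⊕ (ℕ × ℕ)) K) ^ k) := by
    apply Finset.prod_congr rfl
    intro p hp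
    simp only [gg_good (hb p (by simpa using hp))]
  rw [this, map_prod, algebraMap_eq, C_mul_monomial, mul_one]

lemma zon_of_not_bad (hm : 1 ≤ m) {T : Finset ℕ} (hT : ∀ v ∈ T, 1 ≤ v ∧ v ≤ n) (u : Ex)
    (hb : ∀ p, u p ≠ 0 → ¬ (pr m n p ∧ p.2 ∈ T)) : zon (u.mapDomain (ww m n)) T := by
  intro v hv
  by_contra h
  obtain ⟨x, hx, hx'⟩ := exists_of_mapDomain_ne_zero _ _ _ h
  have hvn := hT v hv
  by_cases hp : pr m n x
  · apply hb x hx'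
    rw [ww_pr hp, Prod.mk.injEq] at hx
    refine ⟨hp, ?_⟩
    rw [hx.2]; exact hv
  · rw [ww_npr hp] at hx
    apply hp
    subst hx
    simp [pr]; omega

lemma coeff_phi {b : Ex} {T : Finset ℕ} (hb : zon b T) (a : Ex) (f : MvPolynomial (ℕ × ℕ) K) :
    coeff (mk a b) (phi K m n T f) =
      ∑ u ∈ f.support with u.mapDomain (rr m n T) = a ∧ u.mapDomain (ww m n) = b, coeff u f := by
  conv_lhs => rw [f.as_sum, map_sum, coeff_sum]
  rw [Finset.sum_filter]
  apply Finset.sum_congr rfl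
  intro u _
  by_cases hbad : ∃ p, u p ≠ 0 ∧ (pr m n p ∧ p.2 ∈ T)
  · obtain ⟨p, hp, hp'⟩ := hbad
    rw [phi_monomial_bad T u _ p hp hp', if_neg]
    · simp
    · rintro ⟨_, h⟩
      exact not_bad_of_zon hb h p hp hp'
  · push Not at hbad
    rw [phi_monomial_good T u _ (fun p hp h => hbad p hp h.1 h.2), coeff_monomial]
    simp only [mk_inj]

lemma zon_of_coeff_ne (hm : 1 ≤ m) {T : Finset ℕ} (hT : ∀ v ∈ T, 1 ≤ v ∧ v ≤ n) {a b : Ex}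
    {f : MvPolynomial (ℕ × ℕ) K} (h : coeff (mk a b) (phi K m n T f) ≠ 0) : zon b T := by
  rw [f.as_sum, map_sum, coeff_sum] at h
  obtain ⟨u, hu, h⟩ := Finset.exists_ne_zero_of_sum_ne_zero h
  by_cases hbad : ∃ p, u p ≠ 0 ∧ (pr m n p ∧ p.2 ∈ T)
  · obtain ⟨p, hp, hp'⟩ := hbad
    rw [phi_monomial_bad T u _ p hp hp'] at h
    simp at h
  · push Not at hbad
    have hbad' : ∀ p, u p ≠ 0 → ¬ (pr m n p ∧ p.2 ∈ T) := fun p hp h => hbad p hp h.1 h.2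
    rw [phi_monomial_good T u _ hbad', coeff_monomial] at h
    simp only [mk_inj] at h
    have : u.mapDomain (ww m n) = b := by
      by_contra h'
      exact h (if_neg (fun h'' => h' h''.2))
    rw [← this]
    exact zon_of_not_bad hm hT u hbad'

lemma exists_of_coeff_ne {T : Finset ℕ} {a b : Ex} (hb : zon b T)
    {f : MvPolynomial (ℕ × ℕ) K} (h : coeff (mk a b) (phi K m n T f) ≠ 0) :
    ∃ u ∈ f.support, u.mapDomain (rr m n T) = a ∧ u.mapDomain (ww m n) = b := by
  rw [coeff_phi hb] at h
  obtain ⟨u, hu, _⟩ := Finset.exists_ne_zero_of_sum_ne_zero h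
  exact ⟨u, by simpa using hu⟩

/-- merging lemma: `U` fine, `T` coarse -/
lemma coeff_merge {T U : Finset ℕ} {b : Ex} (hT : zon b T) (hU : zon b U)
    (ρ : ℕ × ℕ → ℕ × ℕ) (hρ : ∀ p, b (ww m n p) ≠ 0 → rr m n T p = ρ (rr m n U p))
    (f : MvPolynomial (ℕ × ℕ) K) (a : Ex) :
    coeff (mk a b) (phi K m n T f) =
      ∑ a' ∈ f.support.image (fun u => u.mapDomain (rr m n U)) with a'.mapDomain ρ = a,
        coeff (mk a' b) (phi K m n U f) := by
  have key : ∀ u : Ex, u.mapDomain (ww m n) = b →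
      u.mapDomain (rr m n T) = (u.mapDomain (rr m n U)).mapDomain ρ := by
    intro u hu
    rw [← Finsupp.mapDomain_comp]
    apply Finsupp.mapDomain_congr
    intro p hp
    apply hρ
    rw [← hu]
    exact mapDomain_ne_zero _ _ _ (by simpa using hp)
  rw [coeff_phi hT, ← Finset.sum_fiberwise_of_maps_to (g := fun u => u.mapDomain (rr m n U))
    (t := (f.support.image (fun u => u.mapDomain (rr m n U))).filter (fun a' => a'.mapDomain ρ = a))]
  · apply Finset.sum_congr rfl
    intro a' ha'
    rw [coeff_phi hU]
    apply Finset.sum_congr _ (fun _ _ => rfl)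
    ext u
    simp only [Finset.mem_filter] at ha' ⊢
    constructor
    · rintro ⟨⟨h1, h2, h3⟩, h4⟩
      exact ⟨h1, h4, h3⟩
    · rintro ⟨h1, h2, h3⟩
      refine ⟨⟨h1, ?_, h3⟩, h2⟩
      rw [key u h3, h2, ha'.2]
  · intro u hu
    simp only [Finset.mem_filter] at hu ⊢
    refine ⟨Finset.mem_image_of_mem _ hu.1, ?_⟩
    rw [← key u hu.2.2, hu.2.1]

end coeffs

/-- reformulated graph hypothesis -/
def GH (n : ℕ) (D : Finset ℕ) (G : SimpleGraph ℕ) : Prop :=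
  (∀ v ∈ D, 1 < v ∧ v < n) ∧
    ∀ k l, k < l → (G.Adj k l ↔ 1 ≤ k ∧ l ≤ n ∧ ∀ w ∈ D, ¬ (k < w ∧ w < l))

def cg (K : Type*) [Field K] (m : ℕ) (G : SimpleGraph ℕ) (u u' : Ex) : Prop :=
  monomial u (1 : K) - monomial u' 1 ∈ genBEI K m G

section congr
variable {K : Type*} [Field K] {m n : ℕ} {D : Finset ℕ} {G : SimpleGraph ℕ}

lemma cg_refl (u : Ex) : cg K m G u u := by simp [cg]

lemma cg_symm {u v : Ex} (h : cg K m G u v) : cg K m G v u := by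
  have := neg_mem h
  rwa [neg_sub] at this

lemma cg_trans {u v w : Ex} (h : cg K m G u v) (h' : cg K m G v w) : cg K m G u w := by
  have := add_mem h h'
  rwa [sub_add_sub_cancel] at this

lemma cg_add {u v : Ex} (h : cg K m G u v) (z : Ex) : cg K m G (u + z) (v + z) := by
  have := Ideal.mul_mem_right (monomial z 1) _ h
  rwa [sub_mul, monomial_mul, monomial_mul, one_mul] at this

noncomputable abbrev sg (i k : ℕ) : Ex := Finsupp.single (i, k) 1

lemma cg_swap_adj {i j k l : ℕ} (hi : 1 ≤ i ∧ i ≤ m) (hj : 1 ≤ j ∧ j ≤ m) (hkl : k < l)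
    (h : G.Adj k l) : cg K m G (sg i k + sg j l) (sg i l + sg j k) := by
  have key : ∀ i j : ℕ, 1 ≤ i → i < j → j ≤ m →
      cg K m G (sg i k + sg j l) (sg i l + sg j k) := by
    intro i j h1 h2 h3
    have : minor K i j k l ∈ genBEI K m G :=
      Ideal.subset_span ⟨i, j, k, l, h1, h2, h3, hkl, h, rfl⟩
    simpa [cg, minor, X, monomial_mul] using this
  rcases lt_trichotomy i j with h1 | h1 | h1
  · exact key i j hi.1 h1 hj.2
  · subst h1
    rw [add_comm]
    exact cg_refl _
  · have := cg_symm (key j i hj.1 h1 hi.2)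
    rw [add_comm (sg i k), add_comm (sg i l)]
    exact this

lemma cg_swap_chain (hG : GH n D G) (d : ℕ) : ∀ {i j k l : ℕ} (z : Ex), l - k ≤ d →
    (1 ≤ i ∧ i ≤ m) → (1 ≤ j ∧ j ≤ m) → k < l → 1 ≤ k → l ≤ n →
    (∀ w ∈ D, k < w → w < l → ∃ h, 1 ≤ h ∧ h ≤ m ∧ z (h, w) ≠ 0) →
    cg K m G (sg i k + sg j l + z) (sg i l + sg j k + z) := by
  induction d with
  | zero => intros; omega
  | succ d ih =>
    intro i j k l z hd hi hj hkl hk hl hocc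
    by_cases hcut : ∃ w ∈ D, k < w ∧ w < l
    · obtain ⟨w, hw, hkw, hwl⟩ := hcut
      obtain ⟨h, hh1, hh2, hz⟩ := hocc w hw hkw hwl
      obtain ⟨z', rfl⟩ : ∃ z', z = sg h w + z' := by
        refine ⟨z - sg h w, ?_⟩
        rw [add_tsub_cancel_of_le]
        rw [Finsupp.single_le_iff]
        omega
      have hocc' : ∀ w' ∈ D, k < w' → w' < l → w' ≠ w →
          ∃ h, 1 ≤ h ∧ h ≤ m ∧ z' (h, w') ≠ 0 := by
        intro w' hw' h1 h2 h3
        obtain ⟨h', a1, a2, a3⟩ := hocc w' hw' h1 h2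
        refine ⟨h', a1, a2, ?_⟩
        simpa [Finsupp.single_apply, h3.symm] using a3
      have s1 := ih (i := i) (j := h) (k := k) (l := w) (sg j l + z') (by omega) hi ⟨hh1, hh2⟩ hkw hk
        (by omega) (by
          intro w' hw' h1 h2
          obtain ⟨h', a1, a2, a3⟩ := hocc' w' hw' h1 (by omega) (by omega)
          refine ⟨h', a1, a2, ?_⟩
          simp only [Finsupp.add_apply]
          omega)
      have s2 := ih (i := i) (j := j) (k := w) (l := l) (sg h k + z') (by omega) hi hj hwl
        (by omega) hl (by
          intro w' hw' h1 h2
          obtain ⟨h', a1, a2, a3⟩ := hocc' w' hw' (by omega) (by omega) (by omega)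
          refine ⟨h', a1, a2, ?_⟩
          simp only [Finsupp.add_apply]
          omega)
      have s3 := ih (i := h) (j := j) (k := k) (l := w) (sg i l + z') (by omega) ⟨hh1, hh2⟩ hj hkw hk
        (by omega) (by
          intro w' hw' h1 h2
          obtain ⟨h', a1, a2, a3⟩ := hocc' w' hw' h1 (by omega) (by omega)
          refine ⟨h', a1, a2, ?_⟩
          simp only [Finsupp.add_apply]
          omega)
      have e1 : sg i k + sg j l + (sg h w + z') = sg i k + sg h w + (sg j l + z') := by abel
      have e2 : sg i w + sg h k + (sg j l + z') = sg i w + sg j l + (sg h k + z') := by abel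
      have e3 : sg i l + sg j w + (sg h k + z') = sg h k + sg j w + (sg i l + z') := by abel
      have e4 : sg h w + sg j k + (sg i l + z') = sg i l + sg j k + (sg h w + z') := by abel
      rw [e1]
      refine cg_trans s1 ?_
      rw [e2]
      refine cg_trans s2 ?_
      rw [e3]
      refine cg_trans s3 ?_
      rw [e4]
      exact cg_refl _
    · apply cg_add
      apply cg_swap_adj hi hj hkl
      rw [hG.2 k l hkl]
      exact ⟨hk, hl, fun w hw h => hcut ⟨w, hw, h⟩⟩

lemma cc_mono (T : Finset ℕ) {x y : ℕ} (h : x ≤ y) : cc T x ≤ cc T y := by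
  apply Finset.card_le_card
  intro w hw
  simp only [Finset.mem_filter] at hw ⊢
  exact ⟨hw.1, by omega⟩

lemma cc_lt (T : Finset ℕ) {x y w : ℕ} (hw : w ∈ T) (h1 : x ≤ w) (h2 : w < y) :
    cc T x < cc T y := by
  apply Finset.card_lt_card
  rw [Finset.ssubset_iff_of_subset]
  · exact ⟨w, by simp [hw, h2], by simp [hw, h1]⟩
  · intro w hw
    simp only [Finset.mem_filter] at hw ⊢
    exact ⟨hw.1, by omega⟩

lemma cc_eq (T : Finset ℕ) {x y : ℕ} (h : x ≤ y) (h' : ∀ w ∈ T, ¬ (x ≤ w ∧ w < y)) :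
    cc T x = cc T y := by
  unfold cc
  congr 1
  ext w
  simp only [Finset.mem_filter]
  constructor
  · rintro ⟨a, b⟩
    exact ⟨a, by omega⟩
  · rintro ⟨a, b⟩
    refine ⟨a, ?_⟩
    have := h' w a
    omega

lemma cg_swap_any (hG : GH n D G) {i j k l : ℕ} (z : Ex) (hi : 1 ≤ i ∧ i ≤ m) (hj : 1 ≤ j ∧ j ≤ m)
    (hk : 1 ≤ k ∧ k ≤ n) (hl : 1 ≤ l ∧ l ≤ n) (T : Finset ℕ) (hT : cc T k = cc T l)
    (hocc : ∀ w ∈ D, w ∉ T → w ≠ k → w ≠ l → ∃ h, 1 ≤ h ∧ h ≤ m ∧ z (h, w) ≠ 0) :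
    cg K m G (sg i k + sg j l + z) (sg i l + sg j k + z) := by
  rcases lt_trichotomy k l with h | h | h
  · apply cg_swap_chain hG (l - k) z le_rfl hi hj h hk.1 hl.2
    intro w hw h1 h2
    apply hocc w hw _ (by omega) (by omega)
    intro hwT
    have := cc_lt T hwT h1.le h2
    omega
  · subst h
    exact cg_refl _
  · rw [add_comm (sg i k), add_comm (sg i l)]
    apply cg_swap_chain hG (k - l) z le_rfl hj hi h hl.1 hk.2
    intro w hw h1 h2
    apply hocc w hw _ (by omega) (by omega)
    intro hwT
    have := cc_lt T hwT h1.le h2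
    omega

/-- unoccupied cut vertices -/
def zs (D : Finset ℕ) (b : Ex) : Finset ℕ := D.filter (fun v => b (1, v) = 0)

lemma cg_of_key (hG : GH n D G) (hm : 1 ≤ m) (u' : Ex) (d : ℕ) : ∀ u : Ex,
    (u - u').degree ≤ d →
    u.mapDomain (ww m n) = u'.mapDomain (ww m n) →
    u.mapDomain (rr m n (zs D (u'.mapDomain (ww m n)))) =
      u'.mapDomain (rr m n (zs D (u'.mapDomain (ww m n)))) → cg K m G u u' := by
  set T := zs D (u'.mapDomain (ww m n)) with hTdef
  induction d with
  | zero =>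
    intro u hd hw hr
    have h0 : u - u' = 0 := by
      rw [← Finsupp.degree_eq_zero_iff]; omega
    have hle : u ≤ u' := by
      rwa [tsub_eq_zero_iff_le] at h0
    have : u = u' := by
      by_contra hne
      obtain ⟨x, hx⟩ : ∃ x, u x ≠ u' x := by
        by_contra h
        push Not at h
        exact hne (Finsupp.ext h)
      obtain ⟨x', _, h2⟩ := exists_lt_of_mapDomain_eq _ _ _ hw.symm x
        (lt_of_le_of_ne (hle x) hx)
      exact absurd (hle x') (by omega)
    rw [this]
    exact cg_refl _
  | succ d ih =>
    intro u hd hw hr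
    by_cases hle : u ≤ u'
    · apply ih u _ hw hr
      rw [tsub_eq_zero_of_le hle]
      simp
    obtain ⟨p, hp⟩ : ∃ p, u' p < u p := by
      by_contra h
      push Not at h
      exact hle h
    obtain ⟨p', hp', hlt⟩ := exists_lt_of_mapDomain_eq _ _ _ hw p hp
    have hpne : p' ≠ p := by rintro rfl; omega
    have hprp : pr m n p ∧ pr m n p' := by
      by_cases h1 : pr m n p <;> by_cases h2 : pr m n p'
      · exact ⟨h1, h2⟩
      · exfalso
        rw [ww_pr h1, ww_npr h2] at hp'
        apply h2
        rw [hp']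
        unfold pr at h1 ⊢
        simp
        omega
      · exfalso
        rw [ww_pr h2, ww_npr h1] at hp'
        apply h1
        rw [← hp']
        unfold pr at h2 ⊢
        simp
        omega
      · rw [ww_npr h1, ww_npr h2] at hp'
        exact absurd hp' hpne
    obtain ⟨i, k⟩ := p
    obtain ⟨j, k'⟩ := p'
    rw [ww_pr hprp.1, ww_pr hprp.2] at hp'
    obtain rfl : k' = k := by simpa using hp'
    obtain ⟨p'', hp'', hlt''⟩ := exists_lt_of_mapDomain_eq _ _ _ hr.symm _ hlt
    have hprp'' : pr m n p'' := by
      by_contra h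
      rw [rr_npr h, rr_pr hprp.2] at hp''
      have := hprp.2.1
      simp at hp'' this
      omega
    rw [rr_pr hprp'', rr_pr hprp.2] at hp''
    obtain ⟨j', l⟩ := p''
    simp only [Prod.mk.injEq] at hp''
    obtain ⟨rfl, hcc⟩ := hp''
    obtain ⟨⟨hi1, hi2, hk1, hk2⟩, ⟨hj1, hj2, -, -⟩⟩ := hprp
    obtain ⟨-, -, hl1, hl2⟩ := hprp''
    simp only at hi1 hi2 hk1 hk2 hj1 hj2 hl1 hl2
    have hij : j' ≠ i := by rintro rfl; exact hpne rfl
    have hkl : l ≠ k' := by rintro rfl; omega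
    obtain ⟨z, rfl⟩ : ∃ z, u = sg i k' + sg j' l + z := by
      refine ⟨u - (sg i k' + sg j' l), ?_⟩
      rw [add_tsub_cancel_of_le]
      intro q
      simp only [Finsupp.add_apply, Finsupp.single_apply]
      split_ifs with h1 h2 h2
      · subst h1; simp at h2; omega
      · subst h1; omega
      · subst h2; omega
      · omega
    have hocc : ∀ w ∈ D, w ∉ T → w ≠ k' → w ≠ l → ∃ h, 1 ≤ h ∧ h ≤ m ∧ z (h, w) ≠ 0 := by
      intro w hwD hwT h1 h2
      have hb : u'.mapDomain (ww m n) (1, w) ≠ 0 := by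
        intro h
        exact hwT (by simp [hTdef, zs, hwD, h])
      rw [← hw] at hb
      obtain ⟨x, hx, hx'⟩ := exists_of_mapDomain_ne_zero _ _ _ hb
      have hD := hG.1 w hwD
      have hprx : pr m n x := by
        by_contra h
        rw [ww_npr h] at hx
        apply h
        subst hx
        unfold pr
        simp
        omega
      rw [ww_pr hprx] at hx
      obtain ⟨h, y⟩ := x
      simp only [Prod.mk.injEq, true_and] at hx
      subst hx
      refine ⟨h, hprx.1, hprx.2.1, ?_⟩
      simpa [Finsupp.single_apply, h1.symm, h2.symm] using hx'
    have hsw := cg_swap_any (K := K) (m := m) hG (i := i) (j := j') (k := k') (l := l) z ⟨hi1, hi2⟩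
      ⟨hj1, hj2⟩ ⟨hk1, hk2⟩ ⟨hl1, hl2⟩ T hcc.symm hocc
    refine cg_trans hsw ?_
    have pik : pr m n (i, k') := ⟨hi1, hi2, hk1, hk2⟩
    have pil : pr m n (i, l) := ⟨hi1, hi2, hl1, hl2⟩
    have pjk : pr m n (j', k') := ⟨hj1, hj2, hk1, hk2⟩
    have pjl : pr m n (j', l) := ⟨hj1, hj2, hl1, hl2⟩
    apply ih
    · have hpt : (sg i l + sg j' k' + z - u') + (sg i k' + sg j' l) ≤
          (sg i k' + sg j' l + z - u') + sg i l := by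
        intro q
        have c1 : q = (i, k') ∨ q ≠ (i, k') := em _
        have c2 : q = (i, l) ∨ q ≠ (i, l) := em _
        have c3 : q = (j', k') ∨ q ≠ (j', k') := em _
        have c4 : q = (j', l) ∨ q ≠ (j', l) := em _
        simp only [Finsupp.add_apply, Finsupp.single_apply, Prod.mk.injEq, hij, hij.symm, hkl, hkl.symm,
          Finsupp.tsub_apply, if_true, if_false, and_true, and_false, true_and, and_self] at hp hlt hlt'' ⊢
        rcases c1 with rfl | c1
        · simp [hij, hkl]; omega
        rcases c2 with rfl | c2
        · simp [hij, hkl, hkl.symm]; omega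
        rcases c3 with rfl | c3
        · simp [hij, hij.symm, hkl]; omega
        rcases c4 with rfl | c4
        · simp [hij, hij.symm, hkl, hkl.symm]; omega
        simp [c1.symm, c2.symm, c3.symm, c4.symm]
      have := (Finsupp.degree_mono hpt)
      simp only [map_add, Finsupp.degree_single] at this
      omega
    · rw [← hw]
      simp only [Finsupp.mapDomain_add, Finsupp.mapDomain_single, ww_pr pik, ww_pr pil, ww_pr pjk,
        ww_pr pjl]
      abel
    · rw [← hr]
      simp only [Finsupp.mapDomain_add, Finsupp.mapDomain_single, rr_pr pik, rr_pr pil, rr_pr pjk,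
        rr_pr pjl, hcc]

lemma mem_of_class {κ : Type*} [DecidableEq κ] (key : Ex → κ)
    (hkey : ∀ u u', key u = key u' → cg K m G u u') (f : MvPolynomial (ℕ × ℕ) K)
    (hf : ∀ u0 ∈ f.support, ∑ u ∈ f.support with key u = key u0, coeff u f = 0) :
    f ∈ genBEI K m G := by
  rw [f.as_sum, ← Finset.sum_fiberwise_of_maps_to (g := key) (t := f.support.image key)
    (fun i hi => Finset.mem_image_of_mem _ hi)]
  apply Ideal.sum_mem
  intro x hx
  obtain ⟨u0, hu0, rfl⟩ := Finset.mem_image.1 hx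
  have e : ∑ u ∈ f.support with key u = key u0, monomial u (coeff u f) =
      ∑ u ∈ f.support with key u = key u0, C (coeff u f) * (monomial u 1 - monomial u0 1) := by
    have : ∑ u ∈ f.support with key u = key u0, monomial u0 (coeff u f) = 0 := by
      rw [← map_sum, hf u0 hu0, map_zero]
    rw [← sub_zero (∑ u ∈ f.support with key u = key u0, monomial u (coeff u f)), ← this,
      ← Finset.sum_sub_distrib]
    apply Finset.sum_congr rfl
    intro u _
    rw [mul_sub, C_mul_monomial, C_mul_monomial, mul_one]
  rw [e]
  apply Ideal.sum_mem
  intro u hu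
  apply Ideal.mul_mem_left
  exact hkey u u0 (Finset.mem_filter.1 hu).2

lemma phi_X (T : Finset ℕ) (p : ℕ × ℕ) : phi K m n T (X p) = gg K m n T p := by
  simp [phi]

lemma le_ker (hG : GH n D G) {T : Finset ℕ} (hT : T ⊆ D) {f : MvPolynomial (ℕ × ℕ) K}
    (hf : f ∈ genBEI K m G) : phi K m n T f = 0 := by
  have : genBEI K m G ≤ RingHom.ker (phi K m n T) := by
    apply Ideal.span_le.2
    rintro _ ⟨i, j, k, l, hi, hij, hj, hkl, hadj, rfl⟩
    rw [hG.2 k l hkl] at hadj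
    obtain ⟨hk, hl, hcut⟩ := hadj
    show phi K m n T _ = 0
    simp only [minor, map_sub, map_mul, phi_X]
    have pik : pr m n (i, k) := ⟨hi, by simp; omega, hk, by simp; omega⟩
    have pil : pr m n (i, l) := ⟨hi, by simp; omega, by simp; omega, hl⟩
    have pjk : pr m n (j, k) := ⟨by simp; omega, hj, hk, by simp; omega⟩
    have pjl : pr m n (j, l) := ⟨by simp; omega, hj, by simp; omega, hl⟩
    by_cases hkT : k ∈ T
    · rw [gg_bad ⟨pik, hkT⟩, gg_bad ⟨pjk, hkT⟩]; simp
    by_cases hlT : l ∈ T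
    · rw [gg_bad ⟨pil, hlT⟩, gg_bad ⟨pjl, hlT⟩]; simp
    rw [gg_good (p := (i, k)) (fun h => hkT h.2), gg_good (p := (j, k)) (fun h => hkT h.2),
      gg_good (p := (i, l)) (fun h => hlT h.2), gg_good (p := (j, l)) (fun h => hlT h.2), rr_pr pik, rr_pr pil, rr_pr pjk, rr_pr pjl, ww_pr pik, ww_pr pil,
      ww_pr pjk, ww_pr pjl]
    have : cc T k = cc T l := by
      apply cc_eq T hkl.le
      rintro w hw ⟨h1, h2⟩
      rcases eq_or_lt_of_le h1 with rfl | h1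
      · exact hkT hw
      · exact hcut w (hT hw) ⟨h1, h2⟩
    simp only [this]
    ring
  exact this hf

lemma mem_iff (hG : GH n D G) (hm : 1 ≤ m) (f : MvPolynomial (ℕ × ℕ) K) :
    f ∈ genBEI K m G ↔ ∀ T ⊆ D, phi K m n T f = 0 := by
  refine ⟨fun hf T hT => le_ker hG hT hf, fun hf => ?_⟩
  apply mem_of_class (fun u => (u.mapDomain (ww m n),
    u.mapDomain (rr m n (zs D (u.mapDomain (ww m n))))))
  · intro u u' h
    simp only [Prod.mk.injEq] at h
    obtain ⟨h1, h2⟩ := h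
    rw [h1] at h2
    exact cg_of_key hG hm u' _ u le_rfl h1 h2
  · intro u0 hu0
    have hz : zon (u0.mapDomain (ww m n)) (zs D (u0.mapDomain (ww m n))) := by
      intro v hv
      simp only [zs, Finset.mem_filter] at hv
      exact hv.2
    have := coeff_phi (m := m) (n := n) hz
      (u0.mapDomain (rr m n (zs D (u0.mapDomain (ww m n))))) f
    rw [hf (zs D _) (Finset.filter_subset _ _), coeff_zero] at this
    conv_rhs => rw [this]
    apply Finset.sum_congr _ (fun _ _ => rfl)
    ext u
    simp only [Finset.mem_filter, Prod.mk.injEq]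
    constructor
    · rintro ⟨h1, h2, h3⟩
      rw [h2] at h3
      exact ⟨h1, h3, h2⟩
    · rintro ⟨h1, h2, h3⟩
      refine ⟨h1, h3, ?_⟩
      rw [h3]
      exact h2

end congr

section lower
variable {K : Type*} [Field K] {m n : ℕ} {D : Finset ℕ} {G : SimpleGraph ℕ}

lemma exists_T (hG : GH n D G) (hm : 1 ≤ m) (f : MvPolynomial (ℕ × ℕ) K)
    (P : Ideal (MvPolynomial (ℕ × ℕ) K)) (hP : P.IsPrime)
    (hPf : ∀ g, g ∈ P ↔ g * f ∈ genBEI K m G) :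
    ∃ T ⊆ D, phi K m n T f ≠ 0 ∧ ∀ g, phi K m n T g = 0 → g * f ∈ genBEI K m G := by
  classical
  have key : (D.powerset.filter (fun T => phi K m n T f ≠ 0)).inf
      (fun T => RingHom.ker (phi K m n T)) ≤ P := by
    intro g hg
    rw [hPf, mem_iff hG hm]
    intro T hT
    rw [map_mul]
    by_cases h : phi K m n T f = 0
    · rw [h, mul_zero]
    · have := (Finset.inf_le (f := fun T => RingHom.ker (phi K m n T))
        (show T ∈ D.powerset.filter (fun T => phi K m n T f ≠ 0) by simp [hT, h])) hg
      have h0 : phi K m n T g = 0 := this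
      rw [h0, zero_mul]
  rw [hP.inf_le'] at key
  obtain ⟨T, hT, hle⟩ := key
  simp only [Finset.mem_filter, Finset.mem_powerset] at hT
  exact ⟨T, hT.1, hT.2, fun g hg => (hPf g).1 (hle hg)⟩

def rho (j : ℕ) (p : ℕ × ℕ) : ℕ × ℕ := (p.1, if p.2 ≤ j then p.2 else p.2 - 1)

lemma cc_erase {V : Finset ℕ} {v : ℕ} (hv : v ∈ V) (x : ℕ) :
    cc (V.erase v) x = if cc V x ≤ cc V v then cc V x else cc V x - 1 := by
  by_cases hx : v < x
  · have h1 := cc_lt V hv le_rfl hx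
    rw [if_neg (by omega)]
    unfold cc
    rw [Finset.filter_erase, Finset.card_erase_of_mem (by simp [hv, hx])]
  · have h1 := cc_mono V (not_lt.1 hx)
    rw [if_pos h1]
    unfold cc
    rw [Finset.filter_erase, Finset.erase_eq_of_notMem (by simp [hx])]

lemma rr_erase {V : Finset ℕ} {v : ℕ} (hv : v ∈ V) (p : ℕ × ℕ) :
    rr m n (V.erase v) p = rho (cc V v) (rr m n V p) := by
  by_cases hp : pr m n p
  · rw [rr_pr hp, rr_pr hp, rho, cc_erase hv]
  · rw [rr_npr hp, rr_npr hp]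
    simp [rho]

lemma count (M τ : ℕ) (d lo hi : ℕ → ℕ)
    (h : ∀ j < τ, 1 ≤ lo j ∧ lo j < hi j ∧ hi j ≤ M + 1)
    (hd : ∀ j ≤ τ, 0 < τ → 1 ≤ d j)
    (h2 : ∀ j, j + 1 < τ → d (j + 1) = 1 → lo (j + 1) = hi j) :
    (M + 1) * τ ≤ M * ∑ j ∈ Finset.range (τ + 1), d j := by
  rcases Nat.eq_zero_or_pos τ with rfl | hτ
  · simp
  have key : ∀ k < τ, (M + 1) * k + (M + 1) ≤ M * ∑ j ∈ Finset.range (k + 1), d j + lo k := by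
    intro k
    induction k with
    | zero =>
      intro h0
      have a := (h 0 h0).1
      have b := hd 0 (by omega) hτ
      simp only [zero_add, Finset.sum_range_one]
      nlinarith
    | succ k ih =>
      intro hk
      have a := h (k + 1) hk
      have a' := h k (by omega)
      have b := hd (k + 1) (by omega) hτ
      have c := ih (by omega)
      rw [Finset.sum_range_succ, mul_add]
      have e : M + hi k ≤ M * d (k + 1) + lo (k + 1) := by
        rcases Nat.lt_or_ge (d (k + 1)) 2 with h' | h'
        · have h1 : d (k + 1) = 1 := by omega
          rw [h2 k hk h1, h1]; omega
        · nlinarith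
      nlinarith
  obtain ⟨k, rfl⟩ : ∃ k, τ = k + 1 := ⟨τ - 1, by omega⟩
  have a := key k (by omega)
  have b := hd (k + 1) le_rfl hτ
  have c := h k (by omega)
  rw [Finset.sum_range_succ, mul_add]
  nlinarith

noncomputable def Wt (a : Ex) : ℕ := a.sum fun p k => k * (p.1 * p.2)

noncomputable def S0 (j : ℕ) (a : Ex) : ℕ := a.sum fun p k => k * (if p.2 = j ∧ 1 ≤ p.1 then 1 else 0)

lemma S0_eq (hm : 1 ≤ m) (j : ℕ) (T : Finset ℕ) (u u' : Ex)
    (h : u.mapDomain (ww m n) = u'.mapDomain (ww m n)) :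
    S0 j (u.mapDomain (rr m n T)) = S0 j (u'.mapDomain (rr m n T)) := by
  have key : ∀ u : Ex, S0 j (u.mapDomain (rr m n T)) =
      (u.mapDomain (ww m n)).sum (fun q k => k * (if pr m n q ∧ cc T q.2 = j then 1 else 0)) := by
    intro u
    rw [S0, Finsupp.sum_mapDomain_index (by simp) (by intros; ring),
      Finsupp.sum_mapDomain_index (by simp) (by intros; ring)]
    apply Finset.sum_congr rfl
    intro p _
    simp only
    congr 1
    by_cases hp : pr m n p
    · have hq : pr m n (1, p.2) := ⟨le_rfl, hm, hp.2.2.1, hp.2.2.2⟩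
      rw [rr_pr hp, ww_pr hp]
      simp [hp.1, hq]
    · rw [rr_npr hp, ww_npr hp]
      simp [hp]
  rw [key, key, h]

lemma exchange (j : ℕ) (a a' : Ex)
    (hs : ∀ p, a p ≠ 0 → p = (0, 0) ∨ 1 ≤ p.1) (hs' : ∀ p, a' p ≠ 0 → p = (0, 0) ∨ 1 ≤ p.1)
    (hρ : a.mapDomain (rho j) = a'.mapDomain (rho j)) (hcol : S0 j a = S0 j a')
    (hW : Wt a' ≤ Wt a) (hne : a' ≠ a) :
    ∃ i i', 1 ≤ i ∧ i < i' ∧ a (i, j) ≠ 0 ∧ a (i', j + 1) ≠ 0 := by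
  classical
  by_contra hno
  push Not at hno
  have hrow : ∀ i, a (i, j) + a (i, j + 1) = a' (i, j) + a' (i, j + 1) := by
    intro i
    have e : ∀ a : Ex, a.mapDomain (rho j) (i, j) = a (i, j) + a (i, j + 1) := by
      intro a
      rw [mapDomain_eq_sum (rho j) a (i, j) {(i, j), (i, j + 1)}]
      · rw [Finset.sum_pair (by simp)]
      · rintro ⟨x, y⟩ _
        simp only [Finset.mem_insert, Finset.mem_singleton, Prod.mk.injEq, rho]
        split_ifs <;> omega
      · rintro ⟨x, y⟩
        simp only [Finset.mem_insert, Finset.mem_singleton, Prod.mk.injEq, rho]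
        split_ifs <;> omega
    rw [← e, ← e, hρ]
  have hoth : ∀ i c, c ≠ j → c ≠ j + 1 → a (i, c) = a' (i, c) := by
    intro i c h1 h2
    have e : ∀ a : Ex, a.mapDomain (rho j) (i, if c ≤ j then c else c - 1) = a (i, c) := by
      intro a
      rw [mapDomain_eq_sum (rho j) a _ {(i, c)}]
      · simp
      · rintro ⟨x, y⟩ _
        simp only [Finset.mem_singleton, Prod.mk.injEq, rho]
        split_ifs <;> omega
      · rintro ⟨x, y⟩
        simp only [Finset.mem_singleton, Prod.mk.injEq, rho]
        split_ifs <;> omega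
    rw [← e, ← e, hρ]
  have h0 : a (0, j) = a' (0, j) := by
    have r := hrow 0
    have z1 : a (0, j + 1) = 0 := by
      by_contra h
      have := hs _ h
      simp at this
    have z2 : a' (0, j + 1) = 0 := by
      by_contra h
      have := hs' _ h
      simp at this
    omega
  obtain ⟨θ, hθ1, hθ2, hθ0⟩ : ∃ θ, (∀ i, 1 ≤ i → a (i, j) ≠ 0 → θ ≤ i) ∧
      (∀ i, a (i, j + 1) ≠ 0 → i ≤ θ) ∧ 1 ≤ θ := by
    by_cases hex : ∃ i, 1 ≤ i ∧ a (i, j) ≠ 0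
    · refine ⟨Nat.find hex, fun i h1 h2 => Nat.find_min' hex ⟨h1, h2⟩, ?_, (Nat.find_spec hex).1⟩
      intro i hi
      by_contra hlt
      exact hi (hno _ i (Nat.find_spec hex).1 (by omega) (Nat.find_spec hex).2)
    · push Not at hex
      refine ⟨a.support.sup (fun p => p.1) + 1, fun i h1 h2 => absurd (hex i h1) h2, ?_, by omega⟩
      intro i hi
      have := Finset.le_sup (f := fun p : ℕ × ℕ => p.1) (Finsupp.mem_support_iff.2 hi)
      simp only at this
      omega
  set S1 : Ex → ℕ := fun a => a.sum fun p k => k * (if p.2 = j then p.1 else 0) with hS1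
  have hWS : Wt a + S1 a = Wt a' + S1 a' := by
    have e : ∀ a : Ex, Wt a + S1 a = (a.mapDomain (rho j)).sum
        (fun p k => k * (p.1 * (if p.2 < j then p.2 else p.2 + 1))) := by
      intro a
      rw [Finsupp.sum_mapDomain_index (by simp) (by intros; ring), hS1, Wt]
      simp only [Finsupp.sum, ← Finset.sum_add_distrib]
      apply Finset.sum_congr rfl
      rintro ⟨i, c⟩ _
      simp only [rho]
      rcases lt_trichotomy c j with h | h | h
      · have q1 : c ≠ j := by omega
        have q2 : c ≤ j := by omega
        simp [q1, q2, h]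
      · subst h
        simp
        ring
      · have q1 : c ≠ j := by omega
        have q2 : ¬ c ≤ j := by omega
        have q3 : ¬ c - 1 < j := by omega
        have q4 : c - 1 + 1 = c := by omega
        simp [q1, q2, q3, q4]
    rw [e, e, hρ]
  have hS : S1 a ≤ S1 a' := by omega
  set F := a.support ∪ a'.support with hF
  have Fa : ∀ g : ℕ × ℕ → ℕ, a.sum (fun p k => k * g p) = ∑ p ∈ F, a p * g p := fun g =>
    Finsupp.sum_of_support_subset _ Finset.subset_union_left _ (by simp)
  have Fa' : ∀ g : ℕ × ℕ → ℕ, a'.sum (fun p k => k * g p) = ∑ p ∈ F, a' p * g p := fun g =>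
    Finsupp.sum_of_support_subset _ Finset.subset_union_right _ (by simp)
  have hδ : ∀ p : ℕ × ℕ, p.2 = j → ((a' p : ℤ) - a p) * (p.1 - θ) ≤ 0 := by
    rintro ⟨i, c⟩ hc
    simp only at hc
    subst hc
    rcases Nat.eq_zero_or_pos i with rfl | hi
    · rw [h0]; simp
    have r := hrow i
    simp only
    rcases lt_trichotomy i θ with h | h | h
    · have : a (i, c) = 0 := by
        by_contra h'
        have := hθ1 i hi h'
        omega
      apply mul_nonpos_of_nonneg_of_nonpos <;> push_cast <;> omega
    · subst h; simp
    · have : a (i, c + 1) = 0 := by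
        by_contra h'
        have := hθ2 i h'
        omega
      apply mul_nonpos_of_nonpos_of_nonneg <;> push_cast <;> omega
  have hsum0 : ∑ p ∈ F, (if p.2 = j ∧ 1 ≤ p.1 then ((a' p : ℤ) - a p) else 0) = 0 := by
    rw [S0, S0, Fa, Fa'] at hcol
    have := congrArg (Nat.cast : ℕ → ℤ) hcol
    push_cast at this
    rw [← sub_eq_zero, ← neg_eq_zero, neg_sub, ← Finset.sum_sub_distrib] at this
    refine Eq.trans ?_ this
    apply Finset.sum_congr rfl
    intro p _
    by_cases h : p.2 = j ∧ 1 ≤ p.1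
    · simp only [if_pos h, mul_one]
    · simp only [if_neg h, mul_zero, sub_zero]
  have hsum1 : 0 ≤ ∑ p ∈ F, (if p.2 = j then ((a' p : ℤ) - a p) * p.1 else 0) := by
    simp only [hS1] at hS
    rw [Fa, Fa'] at hS
    have : ((∑ p ∈ F, a p * (if p.2 = j then p.1 else 0) : ℕ) : ℤ) ≤
      ((∑ p ∈ F, a' p * (if p.2 = j then p.1 else 0) : ℕ) : ℤ) := by exact_mod_cast hS
    push_cast at this
    rw [← sub_nonneg, ← Finset.sum_sub_distrib] at this
    refine this.trans (le_of_eq ?_)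
    apply Finset.sum_congr rfl
    intro p _
    split_ifs <;> push_cast <;> ring
  have hsum2 : 0 ≤ ∑ p ∈ F, (if p.2 = j then ((a' p : ℤ) - a p) * (p.1 - θ) else 0) := by
    have e : ∑ p ∈ F, (if p.2 = j then ((a' p : ℤ) - a p) * (p.1 - θ) else 0) =
        ∑ p ∈ F, (if p.2 = j then ((a' p : ℤ) - a p) * p.1 else 0) -
        (∑ p ∈ F, (if p.2 = j ∧ 1 ≤ p.1 then ((a' p : ℤ) - a p) else 0)) * θ := by
      rw [Finset.sum_mul, ← Finset.sum_sub_distrib]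
      apply Finset.sum_congr rfl
      rintro ⟨i, c⟩ _
      by_cases hc : c = j
      · subst hc
        rcases Nat.eq_zero_or_pos i with rfl | hi
        · simp [h0]
        · have hi' : 1 ≤ i := hi
          simp [hi']
          ring
      · simp [hc]
    rw [e, hsum0]
    simpa using hsum1
  have hz : ∀ p ∈ F, (if p.2 = j then ((a' p : ℤ) - a p) * (p.1 - θ) else 0) = 0 := by
    have hle : ∀ p ∈ F, (if p.2 = j then ((a' p : ℤ) - a p) * (p.1 - θ) else 0) ≤ 0 := by
      intro p _
      split_ifs with h
      · exact hδ p h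
      · exact le_rfl
    have := le_antisymm (Finset.sum_nonpos hle) hsum2
    exact (Finset.sum_eq_zero_iff_of_nonpos hle).1 this
  have hnF : ∀ p, p ∉ F → a' p = a p := by
    intro p hp
    simp only [hF, Finset.mem_union, Finsupp.mem_support_iff, not_or, not_not] at hp
    rw [hp.1, hp.2]
  have hcolj : ∀ i, i ≠ θ → a' (i, j) = a (i, j) := by
    intro i hi
    by_cases hp : (i, j) ∈ F
    · have := hz _ hp
      simp only [if_true] at this
      rcases mul_eq_zero.1 this with h | h
      · omega
      · omega
    · exact hnF _ hp
  have hcolθ : a' (θ, j) = a (θ, j) := by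
    by_cases hp : (θ, j) ∈ F
    · rw [Finset.sum_eq_single (θ, j)] at hsum0
      · simp [hθ0] at hsum0
        omega
      · rintro ⟨i, c⟩ _ hne
        split_ifs with h
        · obtain ⟨h1, h2⟩ := h
          simp only at h1
          subst h1
          rw [hcolj i (by rintro rfl; exact hne rfl)]
          simp
        · rfl
      · exact fun h => absurd hp h
    · exact hnF _ hp
  have hcol' : ∀ i, a' (i, j) = a (i, j) := by
    intro i
    by_cases h : i = θ
    · rw [h, hcolθ]
    · exact hcolj i h
  apply hne
  ext ⟨i, c⟩
  by_cases h1 : c = j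
  · rw [h1, hcol']
  by_cases h2 : c = j + 1
  · have := hrow i
    have := hcol' i
    rw [h2]
    omega
  exact (hoth i c h1 h2).symm

lemma rr_supp (T : Finset ℕ) (u : Ex) (p : ℕ × ℕ) (hp : u.mapDomain (rr m n T) p ≠ 0) :
    p = (0, 0) ∨ (1 ≤ p.1 ∧ p.1 ≤ m) := by
  obtain ⟨x, rfl, _⟩ := exists_of_mapDomain_ne_zero _ _ _ hp
  by_cases h : pr m n x
  · right
    rw [rr_pr h]
    exact ⟨h.1, h.2.1⟩
  · left
    exact rr_npr h

lemma cc_insert {V : Finset ℕ} {v : ℕ} (hv : v ∉ V) (x : ℕ) :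
    cc (insert v V) x = cc V x + if v < x then 1 else 0 := by
  unfold cc
  rw [Finset.filter_insert]
  split_ifs with h
  · rw [Finset.card_insert_of_notMem (by simp [hv])]
  · rfl

lemma gg_ne_zero {T : Finset ℕ} {p : ℕ × ℕ} (h : ¬ (pr m n p ∧ p.2 ∈ T)) : gg K m n T p ≠ 0 := by
  rw [gg_good h]
  exact mul_ne_zero (X_ne_zero _) (X_ne_zero _)

lemma phi_minor_ne_zero {T : Finset ℕ} (hm : 2 ≤ m) {k l : ℕ} (hk : 1 ≤ k) (hkn : k ≤ n)
    (hl : 1 ≤ l) (hln : l ≤ n) (hkT : k ∉ T) (hlT : l ∉ T) (hcc : cc T k ≠ cc T l) :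
    phi K m n T (minor K 1 2 k l) ≠ 0 := by
  have pik : pr m n (1, k) := ⟨by simp, by simp; omega, hk, hkn⟩
  have pil : pr m n (1, l) := ⟨by simp, by simp; omega, hl, hln⟩
  have pjk : pr m n (2, k) := ⟨by simp, hm, hk, hkn⟩
  have pjl : pr m n (2, l) := ⟨by simp, hm, hl, hln⟩
  simp only [minor, map_sub, map_mul, phi_X]
  rw [gg_good (p := (1, k)) (fun h => hkT h.2), gg_good (p := (2, k)) (fun h => hkT h.2),
      gg_good (p := (1, l)) (fun h => hlT h.2), gg_good (p := (2, l)) (fun h => hlT h.2),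
      rr_pr pik, rr_pr pil, rr_pr pjk, rr_pr pjl, ww_pr pik, ww_pr pil, ww_pr pjk, ww_pr pjl]
  simp only
  have e : (X (Sum.inl (1, cc T k)) * X (Sum.inr (1, k)) *
      (X (Sum.inl (2, cc T l)) * X (Sum.inr (1, l))) -
      X (Sum.inl (1, cc T l)) * X (Sum.inr (1, l)) *
      (X (Sum.inl (2, cc T k)) * X (Sum.inr (1, k))) :
      MvPolynomial ((ℕ × ℕ) ⊕ (ℕ × ℕ)) K) =
      (X (Sum.inl (1, cc T k)) * X (Sum.inl (2, cc T l)) -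
        X (Sum.inl (1, cc T l)) * X (Sum.inl (2, cc T k))) *
      (X (Sum.inr (1, k)) * X (Sum.inr (1, l))) := by ring
  rw [e]
  refine mul_ne_zero ?_ (mul_ne_zero (X_ne_zero _) (X_ne_zero _))
  intro h
  have h2 := congrArg (eval (fun x : (ℕ × ℕ) ⊕ (ℕ × ℕ) =>
    if x = Sum.inl (1, cc T k) ∨ x = Sum.inl (2, cc T l) then (1 : K) else 0)) h
  simp [hcc, hcc.symm] at h2

lemma lower (hG : GH n D G) (hm : 2 ≤ m) (f : MvPolynomial (ℕ × ℕ) K) (d : ℕ)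
    (hd : f.IsHomogeneous d) (T : Finset ℕ) (hTD : T ⊆ D) (hne : phi K m n T f ≠ 0)
    (hmul : ∀ g, phi K m n T g = 0 → g * f ∈ genBEI K m G) :
    m * D.card ≤ (2 * m - 1) * d := by
  classical
  have hT1 : ∀ v ∈ D, 1 ≤ v ∧ v ≤ n := fun v hv => by
    have := hG.1 v hv
    omega
  obtain ⟨e, he⟩ := MvPolynomial.ne_zero_iff.1 hne
  obtain ⟨a0, b, rfl⟩ := exists_mk e
  have hb : zon b T := zon_of_coeff_ne (by omega) (fun v hv => hT1 v (hTD hv)) he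
  have hX : ∀ v ∈ T, ∀ U ⊆ D, v ∉ U → phi K m n U f = 0 := by
    intro v hv U hU hvU
    have hp : pr m n (1, v) := ⟨le_rfl, by simp; omega, (hT1 v (hTD hv)).1, (hT1 v (hTD hv)).2⟩
    have h1 := hmul (X (1, v)) (by rw [phi_X, gg_bad ⟨hp, hv⟩])
    have h2 := le_ker hG hU h1
    rw [map_mul, phi_X] at h2
    exact (mul_eq_zero.1 h2).resolve_left (gg_ne_zero (fun h => hvU h.2))
  have hmove : ∀ k ∈ T, ∀ v ∈ D, v ∉ T → b (1, v) = 0 →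
      ¬ (∀ x, b (1, x) ≠ 0 → (v < x ↔ k < x)) := by
    intro k hk v hv hvT hbv hx
    have hkv : k ≠ v := by rintro rfl; exact hvT hk
    have hU0 : phi K m n (insert v (T.erase k)) f = 0 := by
      apply hX k hk
      · intro w hw
        rcases Finset.mem_insert.1 hw with rfl | hw
        · exact hv
        · exact hTD (Finset.mem_of_mem_erase hw)
      · simp [hkv]
    have hzU : zon b (insert v (T.erase k)) := by
      intro w hw
      rcases Finset.mem_insert.1 hw with rfl | hw
      · exact hbv
      · exact hb w (Finset.mem_of_mem_erase hw)
    apply he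
    rw [coeff_merge hb hzU id _ f a0, hU0]
    · simp
    · intro p hp
      by_cases hpr : pr m n p
      · rw [ww_pr hpr] at hp
        rw [id, rr_pr hpr, rr_pr hpr]
        congr 1
        conv_lhs => rw [← Finset.insert_erase hk]
        rw [cc_insert (by simp), cc_insert (by simp [hvT])]
        simp [hx _ hp]
      · rw [id, rr_npr hpr, rr_npr hpr]
  have claim1 : ∀ v ∈ D, v ∉ T → b (1, v) ≠ 0 := by
    intro v hv hvT hbv
    have hv1 := hG.1 v hv
    by_cases hk : v - 1 ∈ T
    · apply hmove _ hk v hv hvT hbv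
      intro x hx
      have : x ≠ v := by rintro rfl; exact hx hbv
      omega
    by_cases hl : v + 1 ∈ T
    · apply hmove _ hl v hv hvT hbv
      intro x hx
      have : x ≠ v + 1 := by rintro rfl; exact hx (hb _ hl)
      omega
    have hcT : cc T (v - 1) = cc T (v + 1) := by
      apply cc_eq _ (by omega)
      rintro w hw ⟨h1, h2⟩
      have : w = v - 1 ∨ w = v := by omega
      rcases this with rfl | rfl
      · exact hk hw
      · exact hvT hw
    have hker : phi K m n T (minor K 1 2 (v - 1) (v + 1)) = 0 := by
      have pik : pr m n (1, v - 1) := ⟨by simp, by simp; omega, by simp; omega, by simp; omega⟩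
      have pil : pr m n (1, v + 1) := ⟨by simp, by simp; omega, by simp, by simp; omega⟩
      have pjk : pr m n (2, v - 1) := ⟨by simp, hm, by simp; omega, by simp; omega⟩
      have pjl : pr m n (2, v + 1) := ⟨by simp, hm, by simp, by simp; omega⟩
      simp only [minor, map_sub, map_mul, phi_X]
      rw [gg_good (p := (1, v - 1)) (fun h => hk h.2), gg_good (p := (2, v - 1)) (fun h => hk h.2),
          gg_good (p := (1, v + 1)) (fun h => hl h.2), gg_good (p := (2, v + 1)) (fun h => hl h.2),
          rr_pr pik, rr_pr pil, rr_pr pjk, rr_pr pjl, ww_pr pik, ww_pr pil, ww_pr pjk, ww_pr pjl]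
      simp only [hcT]
      ring
    have hJ := hmul _ hker
    have hUD : insert v T ⊆ D := by
      intro w hw
      rcases Finset.mem_insert.1 hw with rfl | hw
      · exact hv
      · exact hTD hw
    have h2 := le_ker hG hUD hJ
    rw [map_mul] at h2
    have hU0 : phi K m n (insert v T) f = 0 := by
      refine (mul_eq_zero.1 h2).resolve_left (phi_minor_ne_zero hm (by omega) (by omega) (by omega)
        (by omega) ?_ ?_ ?_)
      · simp only [Finset.mem_insert, not_or]
        exact ⟨by omega, hk⟩
      · simp only [Finset.mem_insert, not_or]
        exact ⟨by omega, hl⟩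
      · exact (cc_lt _ (Finset.mem_insert_self v T) (by omega) (by omega)).ne
    have hzU : zon b (insert v T) := by
      intro w hw
      rcases Finset.mem_insert.1 hw with rfl | hw
      · exact hbv
      · exact hb w hw
    apply he
    rw [coeff_merge hb hzU (rho (cc (insert v T) v)) _ f a0, hU0]
    · simp
    · intro p _
      rw [← rr_erase (Finset.mem_insert_self v T), Finset.erase_insert hvT]
  let A := (f.support.image (fun u => u.mapDomain (rr m n T))).filter
    (fun a => coeff (mk a b) (phi K m n T f) ≠ 0)
  have hAmem : ∀ a, coeff (mk a b) (phi K m n T f) ≠ 0 → a ∈ A := by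
    intro a ha
    obtain ⟨u, hu, hu1, hu2⟩ := exists_of_coeff_ne hb ha
    exact Finset.mem_filter.2 ⟨Finset.mem_image.2 ⟨u, hu, hu1⟩, ha⟩
  obtain ⟨a, haA, hmax⟩ := Finset.exists_max_image A Wt ⟨a0, hAmem a0 he⟩
  have hane : coeff (mk a b) (phi K m n T f) ≠ 0 := (Finset.mem_filter.1 haA).2
  obtain ⟨u, hu, hu1, hu2⟩ := exists_of_coeff_ne hb hane
  have hudeg : u.degree = d := by
    by_contra h
    exact (MvPolynomial.mem_support_iff.1 hu) (hd.coeff_eq_zero h)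
  have hex : ∀ j < T.card, ∃ i i', 1 ≤ i ∧ i < i' ∧ i' ≤ m ∧ a (i, j) ≠ 0 ∧ a (i', j + 1) ≠ 0 := by
    intro j hj
    obtain ⟨v, hv, rfl⟩ : ∃ v ∈ T, cc T v = j := by
      have := Finset.surjOn_of_injOn_of_card_le (s := T) (t := Finset.range T.card) (cc T)
        (by
          intro v hv
          simp only [Finset.coe_range, Set.mem_Iio]
          apply Finset.card_lt_card
          rw [Finset.ssubset_iff_of_subset (Finset.filter_subset _ _)]
          exact ⟨v, hv, by simp⟩)
        (by
          intro v hv w hw h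
          rcases lt_trichotomy v w with h1 | h1 | h1
          · have := cc_lt T hv le_rfl h1
            omega
          · exact h1
          · have := cc_lt T hw le_rfl h1
            omega) (by simp)
      obtain ⟨v, hv, h⟩ := this (show j ∈ (Finset.range T.card : Set ℕ) by simpa using hj)
      exact ⟨v, hv, h⟩
    have hU0 : phi K m n (T.erase v) f = 0 :=
      hX v hv _ ((Finset.erase_subset _ _).trans hTD) (by simp)
    have hzU : zon b (T.erase v) := fun w hw => hb w (Finset.mem_of_mem_erase hw)
    have hsum := coeff_merge (m := m) (n := n) hzU hb (rho (cc T v)) (fun p _ => rr_erase hv p) f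
      (a.mapDomain (rho (cc T v)))
    rw [hU0, coeff_zero] at hsum
    obtain ⟨a', hap1, hap2, hap3⟩ : ∃ a', a' ≠ a ∧
        a'.mapDomain (rho (cc T v)) = a.mapDomain (rho (cc T v)) ∧
        coeff (mk a' b) (phi K m n T f) ≠ 0 := by
      by_contra hcon
      push Not at hcon
      rw [Finset.sum_eq_single a] at hsum
      · exact hane hsum.symm
      · intro a' h1 h2
        exact hcon a' h2 (Finset.mem_filter.1 h1).2
      · intro h
        exfalso
        apply h
        simp only [Finset.mem_filter, and_true]
        exact Finset.mem_image.2 ⟨u, hu, hu1⟩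
    obtain ⟨u', hu', hu1', hu2'⟩ := exists_of_coeff_ne hb hap3
    obtain ⟨i, i', h1, h2, h3, h4⟩ := exchange (cc T v) a a'
      (fun p hp => by
        rw [← hu1] at hp
        have := rr_supp T u p hp
        tauto)
      (fun p hp => by
        rw [← hu1'] at hp
        have := rr_supp T u' p hp
        tauto)
      hap2.symm
      (by rw [← hu1, ← hu1']; exact S0_eq (by omega) _ _ _ _ (hu2.trans hu2'.symm))
      (hmax a' (hAmem a' hap3)) hap1
    refine ⟨i, i', h1, h2, ?_, h3, h4⟩
    rw [← hu1] at h4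
    have := rr_supp T u _ h4
    simp at this
    omega
  choose! lo hi hlo using hex
  let dd : ℕ → ℕ := fun j => ∑ i ∈ Finset.Icc 1 m, a (i, j)
  have hdd1 : ∀ j i, 1 ≤ i → i ≤ m → a (i, j) ≠ 0 → 1 ≤ dd j := by
    intro j i h1 h2 h3
    have : a (i, j) ≤ dd j :=
      Finset.single_le_sum (f := fun i => a (i, j)) (fun _ _ => Nat.zero_le _)
        (Finset.mem_Icc.2 ⟨h1, h2⟩)
    omega
  have hcount := count (m - 1) T.card dd lo hi
    (by
      intro j hj
      have := hlo j hj
      omega)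
    (by
      intro j hj hpos
      rcases Nat.lt_or_ge j T.card with h | h
      · obtain ⟨h1, h2, h3, h4, h5⟩ := hlo j h
        exact hdd1 j _ h1 (by omega) h4
      · obtain ⟨h1, h2, h3, h4, h5⟩ := hlo (T.card - 1) (by omega)
        have e : T.card - 1 + 1 = j := by omega
        rw [e] at h5
        exact hdd1 j _ (by omega) (by omega) h5)
    (by
      intro j hj h1
      by_contra hne'
      obtain ⟨a1, a2, a3, a4, a5⟩ := hlo j (by omega)
      obtain ⟨b1, b2, b3, b4, b5⟩ := hlo (j + 1) hj
      have : a (lo (j + 1), j + 1) + a (hi j, j + 1) ≤ dd (j + 1) := by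
        rw [← Finset.sum_pair (f := fun i => a (i, j + 1)) hne']
        apply Finset.sum_le_sum_of_subset
        intro x hx
        simp only [Finset.mem_insert, Finset.mem_singleton] at hx
        rw [Finset.mem_Icc]
        omega
      omega)
  have hm1 : m - 1 + 1 = m := by omega
  rw [hm1] at hcount
  have hle : ∀ (c : Ex) (F : Finset (ℕ × ℕ)), ∑ p ∈ F, c p ≤ c.degree := by
    intro c F
    rw [Finsupp.degree_apply]
    calc ∑ p ∈ F, c p ≤ ∑ p ∈ F ∪ c.support, c p :=
          Finset.sum_le_sum_of_subset Finset.subset_union_left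
      _ = ∑ p ∈ c.support, c p := by
          symm
          apply Finset.sum_subset Finset.subset_union_right
          intro x _ hx
          simpa using hx
  have hsumd : ∑ j ∈ Finset.range (T.card + 1), dd j ≤ d := by
    have h1 := hle a ((Finset.Icc 1 m) ×ˢ (Finset.range (T.card + 1)))
    rw [Finset.sum_product_right] at h1
    rw [← hu1, Finsupp.degree_mapDomain, hudeg] at h1
    rw [hu1] at h1
    exact h1
  have hDT : (D \ T).card ≤ d := by
    have h1 := hle b ((D \ T).map ⟨fun v => (1, v), fun _ _ h => by simpa using h⟩)
    rw [Finset.sum_map] at h1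
    have h3 : b.degree = d := by rw [← hu2, Finsupp.degree_mapDomain, hudeg]
    rw [h3] at h1
    refine le_trans ?_ h1
    rw [Finset.card_eq_sum_ones]
    apply Finset.sum_le_sum
    intro v hv
    rw [Finset.mem_sdiff] at hv
    have := claim1 v hv.1 hv.2
    change 1 ≤ b (1, v)
    omega
  have hcard : D.card = T.card + (D \ T).card := by
    rw [Finset.card_sdiff_of_subset hTD]
    have := Finset.card_le_card hTD
    omega
  rw [hcard]
  obtain ⟨M, rfl⟩ : ∃ M, m = M + 1 := ⟨m - 1, by omega⟩
  simp only [Nat.add_sub_cancel] at hcount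
  have e2 : 2 * (M + 1) - 1 = 2 * M + 1 := by omega
  rw [e2]
  have q1 : M * ∑ j ∈ Finset.range (T.card + 1), dd j ≤ M * d := Nat.mul_le_mul_left _ hsumd
  have q2 : (M + 1) * (D \ T).card ≤ (M + 1) * d := Nat.mul_le_mul_left _ hDT
  nlinarith

end lower

section upper
variable {K : Type*} [Field K] {m n : ℕ}

/-- block determinant -/
noncomputable def bl (K : Type*) [Field K] (s : ℕ) (c : ℕ → ℕ) : MvPolynomial (ℕ × ℕ) K :=
  (Matrix.of fun i j : Fin s => (X (i.1 + 1, c j.1) : MvPolynomial (ℕ × ℕ) K)).det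

lemma phi_bl (U : Finset ℕ) (s : ℕ) (c : ℕ → ℕ) :
    phi K m n U (bl K s c) =
      (Matrix.of fun i j : Fin s => gg K m n U (i.1 + 1, c j.1)).det := by
  rw [bl, AlgHom.map_det]
  congr 1
  ext1 i j
  simp [phi_X]

lemma pr_col {s : ℕ} {c : ℕ → ℕ} (hs : s ≤ m) (hc : ∀ j < s, 1 ≤ c j ∧ c j ≤ n)
    (i j : Fin s) : pr m n (i.1 + 1, c j.1) := by
  have := hc j.1 j.2
  have := i.2
  refine ⟨?_, ?_, ?_, ?_⟩ <;> simp only <;> omega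

lemma phi_bl_zero {s : ℕ} {c : ℕ → ℕ} (hs : s ≤ m) (hc : ∀ j < s, 1 ≤ c j ∧ c j ≤ n)
    (U : Finset ℕ) (j : ℕ) (hj : j < s) (hU : c j ∈ U) : phi K m n U (bl K s c) = 0 := by
  rw [phi_bl]
  apply Matrix.det_eq_zero_of_column_eq_zero ⟨j, hj⟩
  intro i
  exact gg_bad ⟨pr_col hs hc i ⟨j, hj⟩, hU⟩

lemma phi_bl_good {s : ℕ} {c : ℕ → ℕ} (hs : s ≤ m) (hc : ∀ j < s, 1 ≤ c j ∧ c j ≤ n)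
    (U : Finset ℕ) (hU : ∀ j < s, c j ∉ U) :
    phi K m n U (bl K s c) = (∏ j : Fin s, X (Sum.inr (1, c j.1))) *
      (Matrix.of fun i j : Fin s => (X (Sum.inl (i.1 + 1, cc U (c j.1))) :
        MvPolynomial ((ℕ × ℕ) ⊕ (ℕ × ℕ)) K)).det := by
  rw [phi_bl, ← Matrix.det_mul_row]
  congr 1
  ext1 i j
  have hp := pr_col hs hc i j
  simp only [Matrix.of_apply]
  rw [gg_good (fun h => hU j.1 j.2 h.2), rr_pr hp, ww_pr hp, mul_comm]

lemma phi_bl_zero2 {s : ℕ} {c : ℕ → ℕ} (hs : s ≤ m) (hc : ∀ j < s, 1 ≤ c j ∧ c j ≤ n)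
    (U : Finset ℕ) (j j' : ℕ) (hj : j < s) (hj' : j' < s) (hne : j ≠ j')
    (hcc : cc U (c j) = cc U (c j')) : phi K m n U (bl K s c) = 0 := by
  by_cases h : ∃ k < s, c k ∈ U
  · obtain ⟨k, hk, hkU⟩ := h
    exact phi_bl_zero hs hc U k hk hkU
  · push Not at h
    rw [phi_bl_good hs hc U h, Matrix.det_zero_of_column_eq (i := ⟨j, hj⟩) (j := ⟨j', hj'⟩),
      mul_zero]
    · simpa using hne
    · intro i
      simp [hcc]

lemma phi_bl_ne {s : ℕ} {c : ℕ → ℕ} (hs : s ≤ m) (hc : ∀ j < s, 1 ≤ c j ∧ c j ≤ n)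
    (U : Finset ℕ) (hU : ∀ j < s, c j ∉ U)
    (hinj : ∀ j < s, ∀ j' < s, j < j' → cc U (c j) < cc U (c j')) :
    phi K m n U (bl K s c) ≠ 0 := by
  rw [phi_bl_good hs hc U hU]
  apply mul_ne_zero
  · exact Finset.prod_ne_zero_iff.2 fun j _ => X_ne_zero _
  · let ρ : Fin s × Fin s → (ℕ × ℕ) ⊕ (ℕ × ℕ) :=
      fun p => Sum.inl (p.1.1 + 1, cc U (c p.2.1))
    have hρ : Function.Injective ρ := by
      rintro ⟨i, j⟩ ⟨i', j'⟩ h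
      simp only [ρ, Sum.inl.injEq, Prod.mk.injEq] at h
      obtain ⟨h1, h2⟩ := h
      have e1 : i = i' := Fin.ext (by omega)
      have e2 : j = j' := by
        apply Fin.ext
        rcases lt_trichotomy j.1 j'.1 with h | h | h
        · have := hinj _ j.2 _ j'.2 h
          omega
        · exact h
        · have := hinj _ j'.2 _ j.2 h
          omega
      rw [e1, e2]
    have h0 := Matrix.det_mvPolynomialX_ne_zero (Fin s) K
    have h1 : rename ρ (Matrix.mvPolynomialX (Fin s) (Fin s) K).det ≠ 0 := by
      rw [Ne, map_eq_zero_iff _ (rename_injective ρ hρ)]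
      exact h0
    rw [AlgHom.map_det] at h1
    convert h1 using 2
    ext1 i j
    simp [ρ]

lemma bl_hom (s : ℕ) (c : ℕ → ℕ) : (bl K s c).IsHomogeneous s := by
  rw [bl, Matrix.det_apply]
  apply IsHomogeneous.sum
  intro σ _
  have h : (∏ i : Fin s, (Matrix.of fun i j : Fin s =>
      (X (i.1 + 1, c j.1) : MvPolynomial (ℕ × ℕ) K)) (σ i) i).IsHomogeneous
      (∑ _i : Fin s, 1) := by
    apply IsHomogeneous.prod
    intro i _
    exact isHomogeneous_X _ _
  simp only [Finset.sum_const, Finset.card_univ, Fintype.card_fin, smul_eq_mul, mul_one] at h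
  rcases Int.units_eq_one_or (Equiv.Perm.sign σ) with h1 | h1
  · rw [h1, one_smul]; exact h
  · rw [h1, Units.neg_smul, one_smul]; exact h.neg

lemma upper {D : Finset ℕ} {G : SimpleGraph ℕ} (hG : GH n D G) (hm : 1 ≤ m)
    (I : Finset ℕ) (sz : ℕ → ℕ) (c : ℕ → ℕ → ℕ) (T : Finset ℕ) (hTD : T ⊆ D)
    (hs : ∀ x ∈ I, sz x ≤ m) (hc : ∀ x ∈ I, ∀ j < sz x, 1 ≤ c x j ∧ c x j ≤ n)
    (h1 : ∀ w ∈ D, w ∉ T → ∃ x ∈ I, ∃ j < sz x, c x j = w)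
    (h2 : ∀ w ∈ T, ∃ x ∈ I, ∃ j < sz x, ∃ j' < sz x, j ≠ j' ∧ c x j ≤ c x j' ∧
      ∀ u ∈ T, c x j ≤ u → u < c x j' → u = w)
    (h3 : ∀ x ∈ I, ∀ j < sz x, c x j ∉ T)
    (h4 : ∀ x ∈ I, ∀ j < sz x, ∀ j' < sz x, j < j' → cc T (c x j) < cc T (c x j'))
    (g : MvPolynomial (ℕ × ℕ) K) :
    g * ∏ x ∈ I, bl K (sz x) (c x) ∈ genBEI K m G ↔ phi K m n T g = 0 := by
  rw [mem_iff hG hm]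
  constructor
  · intro h
    have := h T hTD
    rw [map_mul, _root_.map_prod] at this
    refine (mul_eq_zero.1 this).resolve_right ?_
    exact Finset.prod_ne_zero_iff.2 fun x hx => phi_bl_ne (hs x hx) (hc x hx) T (h3 x hx) (h4 x hx)
  · intro h U hUD
    rw [map_mul]
    by_cases hUT : U = T
    · rw [hUT, h, zero_mul]
    · rw [_root_.map_prod]
      apply mul_eq_zero_of_right
      rw [Finset.prod_eq_zero_iff]
      by_cases hsub : U ⊆ T
      · obtain ⟨w, hwT, hwU⟩ : ∃ w ∈ T, w ∉ U := by
          by_contra hcon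
          push Not at hcon
          exact hUT (Finset.Subset.antisymm hsub hcon)
        obtain ⟨x, hx, j, hj, j', hj', hne, hle, hu⟩ := h2 w hwT
        refine ⟨x, hx, phi_bl_zero2 (hs x hx) (hc x hx) U j j' hj hj' hne ?_⟩
        apply cc_eq U hle
        rintro u huU ⟨ha, hb⟩
        exact hwU (hu u (hsub huU) ha hb ▸ huU)
      · obtain ⟨w, hwU, hwT⟩ := Finset.not_subset.1 hsub
        obtain ⟨x, hx, j, hj, rfl⟩ := h1 w (hUD hwU) hwT
        exact ⟨x, hx, phi_bl_zero (hs x hx) (hc x hx) U j hj hwU⟩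

end upper

section final
variable {K : Type*} [Field K]

lemma bound_arith (m N d : ℕ) (hm : 2 ≤ m) (h : m * N ≤ (2 * m - 1) * d) :
    (N / (2 * m - 1)) * m + (N % (2 * m - 1) + 1) / 2 +
        (if N % (2 * m - 1) = 0 then 0 else (N % (2 * m - 1) + 1) % 2) ≤ d := by
  obtain ⟨k, rfl⟩ : ∃ k, m = k + 1 := ⟨m - 1, by omega⟩
  have e : 2 * (k + 1) - 1 = 2 * k + 1 := by omega
  rw [e] at h ⊢
  clear e
  have hN := Nat.div_add_mod N (2 * k + 1)
  have hA : N % (2 * k + 1) < 2 * k + 1 := Nat.mod_lt _ (by omega)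
  generalize N / (2 * k + 1) = q at *
  generalize N % (2 * k + 1) = A at *
  subst hN
  obtain ⟨C, hC⟩ : ∃ C, C = (A + 1) / 2 + (if A = 0 then 0 else (A + 1) % 2) := ⟨_, rfl⟩
  rw [add_assoc, ← hC]
  by_contra hcon
  push Not at hcon
  have h5 : (2 * k + 1) * (d + 1) ≤ (2 * k + 1) * (q * (k + 1) + C) := Nat.mul_le_mul_left _ hcon
  have h6 : (k + 1) * A + (2 * k + 1) ≤ (2 * k + 1) * C := by nlinarith
  by_cases hA0 : A = 0
  · subst hA0
    simp at hC
    subst hC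
    omega
  · rw [if_neg hA0] at hC
    rcases Nat.even_or_odd' A with ⟨a, rfl | rfl⟩
    · have : C = a + 1 := by omega
      subst this
      have : 1 ≤ a := by omega
      nlinarith
    · have : C = a + 1 := by omega
      subst this
      nlinarith

lemma mem_colon_iff (I : Ideal (MvPolynomial (ℕ × ℕ) K)) (f g : MvPolynomial (ℕ × ℕ) K) :
    g ∈ Submodule.colon I (Ideal.span {f} : Ideal (MvPolynomial (ℕ × ℕ) K)) ↔ g * f ∈ I := by
  rw [Submodule.mem_colon]
  constructor
  · intro h
    exact h f (Ideal.subset_span rfl)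
  · intro h s hs
    obtain ⟨a, rfl⟩ := Ideal.mem_span_singleton'.1 hs
    have := I.mul_mem_left a h
    rw [smul_eq_mul]
    convert this using 1
    ring

lemma assoc_of_prime (I : Ideal (MvPolynomial (ℕ × ℕ) K)) (f : MvPolynomial (ℕ × ℕ) K)
    (h : (Submodule.colon I (Ideal.span {f} : Ideal (MvPolynomial (ℕ × ℕ) K))).IsPrime) :
    Submodule.colon I (Ideal.span {f} : Ideal (MvPolynomial (ℕ × ℕ) K)) ∈
      associatedPrimes (MvPolynomial (ℕ × ℕ) K) (MvPolynomial (ℕ × ℕ) K ⧸ I) := by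
  refine ⟨h, Ideal.Quotient.mk I f, ?_⟩
  have : Submodule.colon I (Ideal.span {f} : Ideal (MvPolynomial (ℕ × ℕ) K)) =
      Submodule.colon (⊥ : Submodule (MvPolynomial (ℕ × ℕ) K) (MvPolynomial (ℕ × ℕ) K ⧸ I))
        {Ideal.Quotient.mk I f} := by
    ext g
    rw [mem_colon_iff, Submodule.mem_colon_singleton, Submodule.mem_bot,
      ← Ideal.Quotient.eq_zero_iff_mem, map_mul]
    rfl
  rw [← this, h.radical]

lemma exists_f (m n t : ℕ) (hm : 2 ≤ m) (G : SimpleGraph ℕ)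
    (b : ℕ → ℕ) (hlt : ∀ p ≤ t, ∀ p' ≤ t, (b p < b p' ↔ p < p'))
    (hb0 : b 0 = 1) (hbt : b t = n) (N : ℕ) (hN : N + 1 = t)
    (hG : GH n ((Finset.Icc 1 N).image b) G) :
    ∃ (f : MvPolynomial (ℕ × ℕ) K) (T : Finset ℕ),
      f.IsHomogeneous ((N / (2 * m - 1)) * m + (N % (2 * m - 1) + 1) / 2 +
        (if N % (2 * m - 1) = 0 then 0 else (N % (2 * m - 1) + 1) % 2)) ∧
      ∀ g, g * f ∈ genBEI K m G ↔ phi K m n T g = 0 := by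
  obtain ⟨M, hM⟩ : ∃ M, M = 2 * m - 1 := ⟨_, rfl⟩
  rw [← hM]
  have hMpos : 0 < M := by omega
  have hdm := Nat.div_add_mod N M
  have hA : N % M < M := Nat.mod_lt _ hMpos
  obtain ⟨q, hq⟩ : ∃ q, q = N / M := ⟨_, rfl⟩
  obtain ⟨A, hAd⟩ : ∃ A, A = N % M := ⟨_, rfl⟩
  rw [← hq, ← hAd]
  rw [← hAd] at hA
  rw [← hq, ← hAd] at hdm
  have hdm' : q * M + A = N := by rw [mul_comm]; exact hdm
  have hinj : ∀ p ≤ t, ∀ p' ≤ t, b p = b p' → p = p' := by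
    intro p hp p' hp' h
    have := hlt p hp p' hp'
    have := hlt p' hp' p hp
    omega
  have hle : ∀ p ≤ t, ∀ p' ≤ t, (b p ≤ b p' ↔ p ≤ p') := by
    intro p hp p' hp'
    have := hlt p' hp' p hp
    omega
  obtain ⟨sz, hsz⟩ : ∃ sz : ℕ → ℕ, sz = fun x => if x < q then m else if x = q then (A + 1) / 2 else
    (if A = 0 then 0 else (A + 1) % 2) := ⟨_, rfl⟩
  obtain ⟨st, hst⟩ : ∃ st : ℕ → ℕ, st = fun x => if x ≤ q then x * M else N - 1 := ⟨_, rfl⟩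
  have hstep : ∀ x < q, x * M + M ≤ q * M := by
    intro x hx
    have := Nat.mul_le_mul_right M (show x + 1 ≤ q from hx)
    linarith
  have sz1 : ∀ x, x < q → sz x = m := by intro x hx; simp [hsz, hx]
  have sz2 : sz q = (A + 1) / 2 := by simp [hsz]
  have sz3 : sz (q + 1) = (if A = 0 then 0 else (A + 1) % 2) := by simp [hsz]
  have st1 : ∀ x, x ≤ q → st x = x * M := by intro x hx; simp [hst, hx]
  have st3 : st (q + 1) = N - 1 := by simp [hst]
  have hcase : ∀ x ∈ Finset.range (q + 2), ∀ j < sz x,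
      (st x = x * M ∧ 2 * j < M ∧ x * M + 2 * j + 1 ≤ N) ∨
      (sz x = 1 ∧ j = 0 ∧ st x + 1 = N) := by
    intro x hx j hj
    rw [Finset.mem_range] at hx
    rcases lt_trichotomy x q with h | h | h
    · left
      rw [sz1 x h] at hj
      have := hstep x h
      refine ⟨st1 x h.le, ?_, ?_⟩ <;> omega
    · left
      subst h
      rw [sz2] at hj
      refine ⟨st1 x le_rfl, ?_, ?_⟩ <;> omega
    · right
      have : x = q + 1 := by omega
      subst this
      rw [sz3] at hj ⊢
      rw [st3]
      split_ifs at hj ⊢ with h0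
      · omega
      · refine ⟨?_, ?_, ?_⟩ <;> omega
  have hcol : ∀ x ∈ Finset.range (q + 2), ∀ j < sz x, st x + 2 * j + 1 ≤ N := by
    intro x hx j hj
    rcases hcase x hx j hj with h | h
    · omega
    · omega
  obtain ⟨T, hTdef⟩ : ∃ T : Finset ℕ, T =
    ((Finset.Icc 1 (N - 1)).filter (fun p => ((p - 1) % M) % 2 = 1)).image b := ⟨_, rfl⟩
  have memT : ∀ p, p ≤ t → (b p ∈ T ↔ 1 ≤ p ∧ p < N ∧ ((p - 1) % M) % 2 = 1) := by
    intro p hp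
    rw [hTdef, Finset.mem_image]
    constructor
    · rintro ⟨p', h1, h2⟩
      rw [Finset.mem_filter, Finset.mem_Icc] at h1
      have := hinj p' (by omega) p hp h2
      subst this
      omega
    · intro h
      refine ⟨p, ?_, rfl⟩
      rw [Finset.mem_filter, Finset.mem_Icc]
      omega
  have hmod : ∀ x y, y < M → (x * M + y) % M = y := by
    intro x y hy
    rw [add_comm, Nat.add_mul_mod_self_right, Nat.mod_eq_of_lt hy]
  have dec : ∀ p, 1 ≤ p → p ≤ N → ∃ x y, x ≤ q ∧ y < M ∧ p = x * M + y + 1 := by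
    intro p h1 h2
    refine ⟨(p - 1) / M, (p - 1) % M, ?_, Nat.mod_lt _ hMpos, ?_⟩
    · rw [hq]
      exact Nat.div_le_div_right (by omega)
    · have := Nat.div_add_mod (p - 1) M
      rw [mul_comm] at this
      omega
  have hmodp : ∀ x y, y < M → (x * M + y + 1 - 1) % M = y := by
    intro x y hy
    rw [Nat.add_sub_cancel]
    exact hmod x y hy
  refine ⟨∏ x ∈ Finset.range (q + 2), bl K (sz x) (fun j => b (st x + 2 * j + 1)), T, ?_, ?_⟩
  · have h : (∏ x ∈ Finset.range (q + 2), bl K (sz x) (fun j => b (st x + 2 * j + 1))).IsHomogeneous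
        (∑ x ∈ Finset.range (q + 2), sz x) := by
      apply IsHomogeneous.prod
      intro x _
      exact bl_hom _ _
    convert h using 1
    rw [Finset.sum_range_succ, Finset.sum_range_succ, sz3, sz2,
      Finset.sum_congr rfl (fun x hx => sz1 x (Finset.mem_range.1 hx))]
    simp
  · apply upper hG (by omega) _ sz (fun x j => b (st x + 2 * j + 1))
    · rw [hTdef]
      apply Finset.image_subset_image
      intro p hp
      rw [Finset.mem_filter, Finset.mem_Icc] at hp
      rw [Finset.mem_Icc]
      omega
    · intro x hx
      rw [Finset.mem_range] at hx
      rcases lt_trichotomy x q with h | h | h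
      · rw [sz1 x h]
      · subst h
        rw [sz2]
        omega
      · have : x = q + 1 := by omega
        subst this
        rw [sz3]
        split_ifs <;> omega
    · intro x hx j hj
      have := hcol x hx j hj
      have h1 := (hle 0 (by omega) (st x + 2 * j + 1) (by omega)).2 (by omega)
      have h2 := (hle (st x + 2 * j + 1) (by omega) t le_rfl).2 (by omega)
      rw [hb0] at h1
      rw [hbt] at h2
      exact ⟨h1, h2⟩
    · intro w hw hwT
      obtain ⟨p, hp, rfl⟩ := Finset.mem_image.1 hw
      rw [Finset.mem_Icc] at hp
      rw [memT p (by omega)] at hwT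
      obtain ⟨x, y, hx, hy, hpe⟩ := dec p hp.1 hp.2
      by_cases hpar : y % 2 = 0
      · refine ⟨x, Finset.mem_range.2 (by omega), y / 2, ?_, ?_⟩
        · rcases hx.lt_or_eq with h | h
          · rw [sz1 x h]; omega
          · subst h
            rw [sz2]; omega
        · rw [st1 x hx]
          congr 1
          omega
      · have hpN : p = N := by
          by_contra hne
          apply hwT
          refine ⟨hp.1, by omega, ?_⟩
          rw [hpe, hmodp x y hy]
          omega
        have hxq : x = q := by
          by_contra hne
          have := hstep x (by omega)
          omega
        subst hxq
        refine ⟨x + 1, Finset.mem_range.2 (by omega), 0, ?_, ?_⟩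
        · rw [sz3, if_neg (by omega)]
          omega
        · rw [st3]
          congr 1
          omega
    · intro w hw
      have hw' := hw
      rw [hTdef] at hw
      obtain ⟨p, hp, rfl⟩ := Finset.mem_image.1 hw
      rw [Finset.mem_filter, Finset.mem_Icc] at hp
      obtain ⟨⟨hp1, hp2⟩, hp3⟩ := hp
      obtain ⟨x, y, hx, hy, hpe⟩ := dec p hp1 (by omega)
      have hy2 : y % 2 = 1 := by
        rw [hpe, hmodp x y hy] at hp3
        exact hp3
      have hjs : (y + 1) / 2 < sz x := by
        rcases hx.lt_or_eq with h | h
        · rw [sz1 x h]; omega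
        · subst h
          rw [sz2]; omega
      have e1 : st x + 2 * ((y - 1) / 2) + 1 = p - 1 := by
        rw [st1 x hx]; omega
      have e2 : st x + 2 * ((y + 1) / 2) + 1 = p + 1 := by
        rw [st1 x hx]; omega
      refine ⟨x, Finset.mem_range.2 (by omega), (y - 1) / 2, by omega, (y + 1) / 2, hjs,
        by omega, ?_, ?_⟩
      · simp only [e1, e2]
        exact (hle _ (by omega) _ (by omega)).2 (by omega)
      · simp only [e1, e2]
        intro u hu hu1 hu2
        have hu' := hu
        rw [hTdef] at hu
        obtain ⟨p', hp', rfl⟩ := Finset.mem_image.1 hu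
        rw [Finset.mem_filter, Finset.mem_Icc] at hp'
        rw [hle _ (by omega) _ (by omega)] at hu1
        rw [hlt _ (by omega) _ (by omega)] at hu2
        by_cases hpp : p' = p
        · rw [hpp]
        · exfalso
          have e3 : p' = x * M + (y - 1) + 1 := by omega
          have := hp'.2
          rw [e3, hmodp x (y - 1) (by omega)] at this
          omega
    · intro x hx j hj
      have hN' := hcol x hx j hj
      change b (st x + 2 * j + 1) ∉ T
      rw [memT _ (by omega)]
      rintro ⟨h1, h2, h3⟩
      rcases hcase x hx j hj with ⟨ha, hb, hc⟩ | h
      · rw [ha, hmodp x (2 * j) hb] at h3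
        omega
      · omega
    · intro x hx j hj j' hj' hjj
      have hN' := hcol x hx j' hj'
      rcases hcase x hx j' hj' with ⟨ha, hb, hc⟩ | h
      · have hTm : b (st x + (2 * j + 1) + 1) ∈ T := by
          rw [memT _ (by omega)]
          refine ⟨by omega, by omega, ?_⟩
          rw [ha, hmodp x (2 * j + 1) (by omega)]
          omega
        apply cc_lt T hTm
        · exact (hle _ (by omega) _ (by omega)).2 (by omega)
        · exact (hlt _ (by omega) _ (by omega)).2 (by omega)
      · omega

lemma GH_of (n t : ℕ) (G : SimpleGraph ℕ)
    (b : ℕ → ℕ) (hlt : ∀ p ≤ t, ∀ p' ≤ t, (b p < b p' ↔ p < p'))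
    (hb0 : b 0 = 1) (hbt : b t = n) (N : ℕ) (hN : N + 1 = t)
    (hadj : ∀ u v : ℕ, G.Adj u v ↔
      u ≠ v ∧ ∃ i ∈ Set.Icc 1 t,
        u ∈ Set.Icc (b (i - 1)) (b i) ∧ v ∈ Set.Icc (b (i - 1)) (b i)) :
    GH n ((Finset.Icc 1 N).image b) G := by
  have hle : ∀ p ≤ t, ∀ p' ≤ t, (b p ≤ b p' ↔ p ≤ p') := by
    intro p hp p' hp'
    have := hlt p' hp' p hp
    omega
  refine ⟨?_, ?_⟩
  · intro v hv
    obtain ⟨p, hp, rfl⟩ := Finset.mem_image.1 hv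
    rw [Finset.mem_Icc] at hp
    rw [← hb0, ← hbt, hlt _ (by omega) _ (by omega), hlt _ (by omega) _ (by omega)]
    omega
  · intro k l hkl
    rw [hadj]
    constructor
    · rintro ⟨-, i, ⟨hi1, hi2⟩, ⟨hk1, hk2⟩, ⟨hl1, hl2⟩⟩
      have h1 := (hle 0 (by omega) (i - 1) (by omega)).2 (by omega)
      have h2 := (hle i (by omega) t (by omega)).2 (by omega)
      refine ⟨by omega, by omega, ?_⟩
      rintro w hw ⟨hw1, hw2⟩
      obtain ⟨p, hp, rfl⟩ := Finset.mem_image.1 hw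
      rw [Finset.mem_Icc] at hp
      have h3 : b (i - 1) < b p := by omega
      have h4 : b p < b i := by omega
      rw [hlt _ (by omega) _ (by omega)] at h3 h4
      omega
    · rintro ⟨h1, h2, h3⟩
      refine ⟨by omega, ?_⟩
      have hex : ∃ i, l ≤ b i := ⟨t, by omega⟩
      classical
      have hspec := Nat.find_spec hex
      have hmin : ∀ i < Nat.find hex, b i < l := fun i hi => by
        have := Nat.find_min hex hi
        omega
      have hfle : Nat.find hex ≤ t := Nat.find_min' hex (by omega)
      generalize Nat.find hex = i at *
      have hi1 : 1 ≤ i := by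
        by_contra h
        have : i = 0 := by omega
        subst this
        omega
      have hl := hmin (i - 1) (by omega)
      have hk : b (i - 1) ≤ k := by
        by_contra hcon
        by_cases hi0 : i - 1 = 0
        · rw [hi0] at hcon
          omega
        · apply h3 (b (i - 1))
          · apply Finset.mem_image_of_mem
            rw [Finset.mem_Icc]
            omega
          · omega
      refine ⟨i, ⟨hi1, hfle⟩, ⟨hk, by omega⟩, ⟨by omega, hspec⟩⟩

end final

end VN

/-- Theorem 5.9: for a connected Cohen–Macaulay closed graph `G` with `t` maximal cliques
(the consecutive intervals `[b (i-1), b i]`) and `m ≥ 2`, writing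
`t − 1 = q(2m−1) + A` with `0 ≤ A < 2m−1` and `B = (A+1) % 2` if `A > 0`, `B = 0` if
`A = 0`, the v-number of the generalized binomial edge ideal is
`v(J_{K_m,G}) = q·m + ⌊(A+1)/2⌋ + B`. -/
theorem vNumber_genBEI_CM_closed
    (K : Type*) [Field K] (m n t : ℕ) (hm : 2 ≤ m) (ht : 1 ≤ t) (G : SimpleGraph ℕ)
    (b : ℕ → ℕ) (hb0 : b 0 = 1) (hbt : b t = n)
    (hbmono : StrictMonoOn b (Set.Icc 0 t))
    (hadj : ∀ u v : ℕ, G.Adj u v ↔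
      u ≠ v ∧ ∃ i ∈ Set.Icc 1 t,
        u ∈ Set.Icc (b (i - 1)) (b i) ∧ v ∈ Set.Icc (b (i - 1)) (b i)) :
    vNumber (genBEI K m G) =
      ((t - 1) / (2 * m - 1)) * m + ((t - 1) % (2 * m - 1) + 1) / 2 +
        (if (t - 1) % (2 * m - 1) = 0 then 0 else ((t - 1) % (2 * m - 1) + 1) % 2) := by
  
  obtain ⟨N, hN⟩ : ∃ N, N + 1 = t := ⟨t - 1, by omega⟩
  have hN' : t - 1 = N := by omega
  rw [hN']
  have hlt : ∀ p ≤ t, ∀ p' ≤ t, (b p < b p' ↔ p < p') := fun p hp p' hp' =>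
    hbmono.lt_iff_lt ⟨Nat.zero_le _, hp⟩ ⟨Nat.zero_le _, hp'⟩
  have hG := VN.GH_of n t G b hlt hb0 hbt N hN hadj
  have hcard : ((Finset.Icc 1 N).image b).card = N := by
    rw [Finset.card_image_of_injOn, Nat.card_Icc]
    · omega
    · intro p hp p' hp' h
      simp only [Finset.coe_Icc, Set.mem_Icc] at hp hp'
      have := hlt p (by omega) p' (by omega)
      have := hlt p' (by omega) p (by omega)
      omega
  rw [vNumber]
  apply le_antisymm
  · apply Nat.sInf_le
    obtain ⟨f, T, hf, hT⟩ := VN.exists_f (K := K) m n t hm G b hlt hb0 hbt N hN hG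
    have hprime : (Submodule.colon (genBEI K m G)
        (Ideal.span {f} : Ideal (MvPolynomial (ℕ × ℕ) K))).IsPrime := by
      have : Submodule.colon (genBEI K m G)
          (Ideal.span {f} : Ideal (MvPolynomial (ℕ × ℕ) K)) =
          RingHom.ker (VN.phi K m n T) := by
        ext g
        rw [VN.mem_colon_iff, hT, RingHom.mem_ker]
      rw [this]
      exact RingHom.ker_isPrime _
    exact ⟨f, hf, hprime, VN.assoc_of_prime _ _ hprime⟩
  · apply le_csInf
    · obtain ⟨f, T, hf, hT⟩ := VN.exists_f (K := K) m n t hm G b hlt hb0 hbt N hN hG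
      have hprime : (Submodule.colon (genBEI K m G)
          (Ideal.span {f} : Ideal (MvPolynomial (ℕ × ℕ) K))).IsPrime := by
        have : Submodule.colon (genBEI K m G)
            (Ideal.span {f} : Ideal (MvPolynomial (ℕ × ℕ) K)) =
            RingHom.ker (VN.phi K m n T) := by
          ext g
          rw [VN.mem_colon_iff, hT, RingHom.mem_ker]
        rw [this]
        exact RingHom.ker_isPrime _
      exact ⟨_, f, hf, hprime, VN.assoc_of_prime _ _ hprime⟩
    · rintro d ⟨f, hf, hprime, -⟩
      obtain ⟨T, hTD, hne, hmul⟩ := VN.exists_T hG (by omega) f _ hprime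
        (fun g => VN.mem_colon_iff _ f g)
      have := VN.lower hG hm f d hf T hTD hne hmul
      rw [hcard] at this
      exact VN.bound_arith m N d hm this
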